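/- Let (X, B, μ) be a probability space and T : X → X an invertible measure-preserving transformation. Then for any 0 < λ < 1 and any A ∈ B with μ(A) > 0, the set {(n, m) ∈ ℤ² : μ((A ∩ TⁿA) ∩ Tᵐ(A ∩ TⁿA)) > λ·μ(A)⁴} is syndetic in ℤ². -/

import Mathlib

open MeasureTheory Filter

/-- A subset of `ℤ²` is syndetic if there is `L > 0` such that it meets every square
`[a, a+L) × [b, b+L)`. -/
def SyndeticZ2 (S : Set (ℤ × ℤ)) : Prop :=
  ∃ L : ℤ, 0 < L ∧ ∀ a b : ℤ, ∃ n m : ℤ,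
    a ≤ n ∧ n < a + L ∧ b ≤ m ∧ m < b + L ∧ (n, m) ∈ S

section HilbertSpace

open scoped InnerProductSpace TensorProduct Topology

variable {H : Type*} [NormedAddCommGroup H] [InnerProductSpace ℝ H]

/-- The mean ergodic theorem: the Cesàro averages of the orbit of `v` under a contraction `V`
converge to the orthogonal projection of `v` on the fixed vectors of `V`. -/
theorem exists_tendsto_cesaro [CompleteSpace H] (V : H →L[ℝ] H) (hV : ‖V‖ ≤ 1) (v : H) :
    ∃ z : H, V z = z ∧ (∀ y, V y = y → ⟪v - z, y⟫_ℝ = 0) ∧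
      Tendsto (fun N : ℕ => (N : ℝ)⁻¹ • ∑ k ∈ Finset.range N, (V ^ k) v) atTop (𝓝 z) := by
  refine ⟨(V.eqLocus (1 : H →L[ℝ] H)).orthogonalProjectionOnto v, ?_, ?_, ?_⟩
  · have := ((V.eqLocus (1 : H →L[ℝ] H)).orthogonalProjectionOnto v).2
    exact this
  · intro y hy
    exact Submodule.starProjection_inner_eq_zero (K := V.eqLocus (1 : H →L[ℝ] H)) v y
      (by simpa using hy)
  · refine (V.tendsto_birkhoffAverage_orthogonalProjection hV v).congr fun N => ?_
    simp [birkhoffAverage, birkhoffSum]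

/-- A completed tensor square of `H` on which an isometry `V` acts diagonally. -/
structure TensorSquare (V : H →ₗᵢ[ℝ] H) (E : Type*) [NormedAddCommGroup E]
    [InnerProductSpace ℝ E] where
  tmul : H → H → E
  inner_tmul : ∀ x y x' y', ⟪tmul x y, tmul x' y'⟫_ℝ = ⟪x, x'⟫_ℝ * ⟪y, y'⟫_ℝ
  map : E →L[ℝ] E
  norm_map_le : ‖map‖ ≤ 1
  map_tmul : ∀ x y, map (tmul x y) = tmul (V x) (V y)

/-- The completion of the algebraic tensor square. -/
noncomputable def TensorSquare.completion (V : H →ₗᵢ[ℝ] H) :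
    TensorSquare V (UniformSpace.Completion (H ⊗[ℝ] H)) where
  tmul x y := ((x ⊗ₜ[ℝ] y : H ⊗[ℝ] H) : UniformSpace.Completion (H ⊗[ℝ] H))
  inner_tmul x y x' y' := by
    rw [UniformSpace.Completion.inner_coe, TensorProduct.inner_tmul]
  map := (TensorProduct.mapIsometry V V).toContinuousLinearMap.completion
  norm_map_le := by
    refine ContinuousLinearMap.opNorm_le_bound _ zero_le_one fun x => ?_
    induction x using UniformSpace.Completion.induction_on with
    | hp => exact isClosed_le (by fun_prop) (by fun_prop)
    | ih a =>
      rw [ContinuousLinearMap.completion_apply_coe, UniformSpace.Completion.norm_coe,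
        UniformSpace.Completion.norm_coe, one_mul]
      exact ((TensorProduct.mapIsometry V V).norm_map a).le
  map_tmul x y := by
    rw [ContinuousLinearMap.completion_apply_coe]
    rfl

section TensorSquare

variable {E : Type*} [NormedAddCommGroup E] [InnerProductSpace ℝ E] {V : H →ₗᵢ[ℝ] H}
  (τ : TensorSquare V E)

theorem TensorSquare.norm_tmul (x y : H) : ‖τ.tmul x y‖ = ‖x‖ * ‖y‖ := by
  rw [← sq_eq_sq₀ (norm_nonneg _) (by positivity), ← real_inner_self_eq_norm_sq, τ.inner_tmul,
    real_inner_self_eq_norm_sq, real_inner_self_eq_norm_sq, mul_pow]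

theorem TensorSquare.norm_average_sq (u : ℕ → H) (N : ℕ) :
    ‖(N : ℝ)⁻¹ • ∑ k ∈ Finset.range N, τ.tmul (u k) (u k)‖ ^ 2 =
      (N : ℝ)⁻¹ * (N : ℝ)⁻¹ *
        ∑ k ∈ Finset.range N, ∑ l ∈ Finset.range N, ⟪u k, u l⟫_ℝ ^ 2 := by
  rw [← real_inner_self_eq_norm_sq, real_inner_smul_left, real_inner_smul_right, sum_inner,
    mul_assoc]
  simp_rw [inner_sum, τ.inner_tmul, pow_two]

theorem TensorSquare.exists_tendsto_average [CompleteSpace E] (w : H) :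
    ∃ z : E, Tendsto (fun N : ℕ => (N : ℝ)⁻¹ • ∑ k ∈ Finset.range N,
        τ.tmul ((V ^ k) w) ((V ^ k) w)) atTop (𝓝 z) ∧ ‖z‖ ^ 2 = ⟪τ.tmul w w, z⟫_ℝ := by
  have hSk : ∀ k : ℕ, (τ.map ^ k) (τ.tmul w w) = τ.tmul ((V ^ k) w) ((V ^ k) w) := by
    intro k
    induction k with
    | zero => simp
    | succ k ih =>
      rw [pow_succ', mul_apply_eq_comp, ih, τ.map_tmul, pow_succ']
      rfl
  obtain ⟨z, hz, hz', hlim⟩ := exists_tendsto_cesaro τ.map τ.norm_map_le (τ.tmul w w)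
  simp_rw [hSk] at hlim
  refine ⟨z, hlim, ?_⟩
  have := hz' z hz
  rw [inner_sub_left, sub_eq_zero] at this
  rw [this, real_inner_self_eq_norm_sq]

end TensorSquare

/-- The operator `x ↦ N⁻¹ ∑_{k < N} ⟪u k, x⟫ u k`. -/
noncomputable def frameAverage (u : ℕ → H) (N : ℕ) : H →L[ℝ] H :=
  (N : ℝ)⁻¹ • ∑ k ∈ Finset.range N, InnerProductSpace.rankOne ℝ (u k) (u k)

theorem frameAverage_apply (u : ℕ → H) (N : ℕ) (x : H) :
    frameAverage u N x = (N : ℝ)⁻¹ • ∑ k ∈ Finset.range N, ⟪u k, x⟫_ℝ • u k := by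
  simp [frameAverage]

theorem TensorSquare.inner_frameAverage {E : Type*} [NormedAddCommGroup E]
    [InnerProductSpace ℝ E] {V : H →ₗᵢ[ℝ] H} (τ : TensorSquare V E) (u : ℕ → H) (N : ℕ) (x y : H) :
    ⟪y, frameAverage u N x⟫_ℝ =
      ⟪τ.tmul y x, (N : ℝ)⁻¹ • ∑ k ∈ Finset.range N, τ.tmul (u k) (u k)⟫_ℝ := by
  rw [frameAverage_apply, real_inner_smul_right, real_inner_smul_right, inner_sum, inner_sum]
  congr 1
  refine Finset.sum_congr rfl fun k _ => ?_
  rw [real_inner_smul_right, τ.inner_tmul, real_inner_comm x, mul_comm]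

theorem TensorSquare.norm_frameAverage_sub_le {E : Type*} [NormedAddCommGroup E]
    [InnerProductSpace ℝ E] {V : H →ₗᵢ[ℝ] H} (τ : TensorSquare V E) (u : ℕ → H) (M N : ℕ) :
    ‖frameAverage u M - frameAverage u N‖ ≤
      ‖((M : ℝ)⁻¹ • ∑ k ∈ Finset.range M, τ.tmul (u k) (u k)) -
        (N : ℝ)⁻¹ • ∑ k ∈ Finset.range N, τ.tmul (u k) (u k)‖ := by
  refine ContinuousLinearMap.opNorm_le_bound _ (norm_nonneg _) fun x => ?_
  set y := (frameAverage u M - frameAverage u N) x with hy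
  have h : ‖y‖ * ‖y‖ ≤ ‖y‖ * (‖((M : ℝ)⁻¹ • ∑ k ∈ Finset.range M, τ.tmul (u k) (u k)) -
        (N : ℝ)⁻¹ • ∑ k ∈ Finset.range N, τ.tmul (u k) (u k)‖ * ‖x‖) := by
    rw [← real_inner_self_eq_norm_mul_norm]
    nth_rewrite 2 [hy]
    rw [sub_apply, inner_sub_right, τ.inner_frameAverage, τ.inner_frameAverage,
      ← inner_sub_right]
    refine (real_inner_le_norm _ _).trans (le_of_eq ?_)
    rw [τ.norm_tmul]
    ring
  rcases (norm_nonneg y).eq_or_lt with h0 | h0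
  · rw [← h0]; positivity
  · exact le_of_mul_le_mul_left h h0

theorem isCompactOperator_frameAverage (u : ℕ → H) (N : ℕ) :
    IsCompactOperator (frameAverage u N) := by
  have : ∀ k, InnerProductSpace.rankOne ℝ (u k) (u k) ∈ compactOperator (RingHom.id ℝ) H H := by
    intro k
    rw [InnerProductSpace.rankOne_def']
    exact (isCompactOperator_of_locallyCompactSpace_rng
      (ContinuousLinearMap.toSpanSingleton ℝ (u k))).comp_clm (innerSL ℝ (u k))
  exact (compactOperator (RingHom.id ℝ) H H).smul_mem _ (Submodule.sum_mem _ fun k _ => this k)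

variable (U : ℤ → H →ₗᵢ[ℝ] H)

/-- The almost periodic vectors of an action, i.e. those with totally bounded orbit. -/
def almostPeriodic : Submodule ℝ H where
  carrier := {v | TotallyBounded (Set.range fun n : ℤ => U n v)}
  zero_mem' := by
    refine (Set.finite_singleton (0 : H)).totallyBounded.subset ?_
    rintro _ ⟨n, rfl⟩
    simp
  add_mem' := by
    intro a b ha hb
    simp only [Set.mem_ofPred_eq, Metric.totallyBounded_iff] at *
    intro ε hε
    obtain ⟨s, hs, hs'⟩ := ha (ε / 2) (half_pos hε)
    obtain ⟨t, ht, ht'⟩ := hb (ε / 2) (half_pos hε)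
    refine ⟨_, hs.image2 (· + ·) ht, ?_⟩
    rintro _ ⟨n, rfl⟩
    obtain ⟨x, hx, hxn⟩ := Set.mem_iUnion₂.1 (hs' ⟨n, rfl⟩)
    obtain ⟨y, hy, hyn⟩ := Set.mem_iUnion₂.1 (ht' ⟨n, rfl⟩)
    refine Set.mem_iUnion₂.2 ⟨x + y, Set.mem_image2_of_mem hx hy, ?_⟩
    rw [Metric.mem_ball] at *
    simp only [map_add]
    linarith [dist_add_add_le (U n a) (U n b) x y]
  smul_mem' := by
    intro c a ha
    simp only [Set.mem_ofPred_eq] at *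
    refine (ha.image (uniformContinuous_const_smul c)).subset ?_
    rintro _ ⟨n, rfl⟩
    exact ⟨U n a, ⟨n, rfl⟩, by simp⟩

theorem mem_almostPeriodic {v : H} :
    v ∈ almostPeriodic U ↔ TotallyBounded (Set.range fun n : ℤ => U n v) := Iff.rfl

theorem isClosed_almostPeriodic : IsClosed (almostPeriodic U : Set H) := by
  refine isClosed_of_closure_subset fun v hv => ?_
  rw [SetLike.mem_coe, mem_almostPeriodic, Metric.totallyBounded_iff]
  intro ε hε
  obtain ⟨a, ha, hav⟩ := Metric.mem_closure_iff.1 hv (ε / 2) (half_pos hε)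
  obtain ⟨s, hs, hs'⟩ := Metric.totallyBounded_iff.1 ha (ε / 2) (half_pos hε)
  refine ⟨s, hs, ?_⟩
  rintro _ ⟨n, rfl⟩
  obtain ⟨x, hx, hxn⟩ := Set.mem_iUnion₂.1 (hs' ⟨n, rfl⟩)
  refine Set.mem_iUnion₂.2 ⟨x, hx, ?_⟩
  rw [Metric.mem_ball] at *
  have h : dist (U n v) (U n a) = dist v a := (U n).dist_map v a
  have h' := dist_triangle (U n v) (U n a) x
  simp only at hxn ⊢
  linarith

variable {U}

theorem pow_apply_eq (hU0 : ∀ v, U 0 v = v) (hU : ∀ m n v, U (m + n) v = U m (U n v))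
    (k : ℕ) (w : H) : (U 1 ^ k) w = U k w := by
  induction k with
  | zero => simp [hU0]
  | succ k ih =>
    rw [pow_succ']
    change U 1 ((U 1 ^ k) w) = _
    rw [ih, ← hU]
    push_cast
    rw [add_comm]

/-- The correlations of a vector orthogonal to the almost periodic vectors vanish on average. -/
theorem tendsto_correlations_of_orthogonal [CompleteSpace H]
    (hU0 : ∀ v, U 0 v = v) (hU : ∀ m n v, U (m + n) v = U m (U n v)) {w : H}
    (hw : ∀ v ∈ almostPeriodic U, ⟪w, v⟫_ℝ = 0) :
    Tendsto (fun N : ℕ => (N : ℝ)⁻¹ * (N : ℝ)⁻¹ *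
      ∑ k ∈ Finset.range N, ∑ l ∈ Finset.range N, ⟪U k w, U l w⟫_ℝ ^ 2) atTop (𝓝 0) := by
  let τ := TensorSquare.completion (U 1)
  obtain ⟨z, hz, hz'⟩ := τ.exists_tendsto_average w
  simp_rw [pow_apply_eq hU0 hU] at hz
  set u : ℕ → H := fun k => U k w with hu
  have hcau : CauchySeq (frameAverage u) := by
    have h1 := hz.cauchySeq
    rw [Metric.cauchySeq_iff] at h1 ⊢
    intro ε hε
    obtain ⟨N, hN⟩ := h1 ε hε
    refine ⟨N, fun m hm n hn => lt_of_le_of_lt ?_ (hN m hm n hn)⟩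
    rw [dist_eq_norm, dist_eq_norm]
    exact τ.norm_frameAverage_sub_le u m n
  obtain ⟨B, hB⟩ := cauchySeq_tendsto_of_complete hcau
  have hBx : ∀ x, Tendsto (fun N => frameAverage u N x) atTop (𝓝 (B x)) := fun x =>
    ((ContinuousLinearMap.apply ℝ H x).continuous.tendsto B).comp hB
  have hcomp : IsCompactOperator B :=
    isCompactOperator_of_tendsto hB (Eventually.of_forall (isCompactOperator_frameAverage u))
  have hcomm1 : ∀ x, U 1 (B x) = B (U 1 x) := by
    intro x
    have h1 : Tendsto (fun N => U 1 (frameAverage u N x) - frameAverage u N (U 1 x)) atTop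
        (𝓝 (U 1 (B x) - B (U 1 x))) :=
      (((U 1).continuous.tendsto _).comp (hBx x)).sub (hBx (U 1 x))
    have h2 : Tendsto (fun N => U 1 (frameAverage u N x) - frameAverage u N (U 1 x)) atTop
        (𝓝 0) := by
      have hbound : ∀ N : ℕ, ‖U 1 (frameAverage u N x) - frameAverage u N (U 1 x)‖ ≤
          (N : ℝ)⁻¹ * (2 * ‖w‖ * ‖w‖ * ‖x‖) := by
        intro N
        have hkey : U 1 (frameAverage u N x) - frameAverage u N (U 1 x) =
            (N : ℝ)⁻¹ • (⟪u N, U 1 x⟫_ℝ • u N - ⟪u 0, U 1 x⟫_ℝ • u 0) := by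
          rw [frameAverage_apply, frameAverage_apply, map_smul, ← smul_sub, map_sum,
            ← Finset.sum_sub_distrib, ← Finset.sum_range_sub (fun k => ⟪u k, U 1 x⟫_ℝ • u k)]
          congr 1
          refine Finset.sum_congr rfl fun k _ => ?_
          have : u (k + 1) = U 1 (u k) := by
            simp only [hu]
            rw [← hU]
            push_cast
            rw [add_comm]
          rw [this, (U 1).inner_map_map, map_smul]
        have hun : ∀ k, ‖u k‖ = ‖w‖ := fun k => (U k).norm_map w
        have hterm : ∀ k, ‖⟪u k, U 1 x⟫_ℝ • u k‖ ≤ ‖w‖ * ‖w‖ * ‖x‖ := by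
          intro k
          rw [norm_smul, hun]
          have := norm_inner_le_norm (𝕜 := ℝ) (u k) (U 1 x)
          rw [hun, (U 1).norm_map] at this
          nlinarith [norm_nonneg w]
        rw [hkey, norm_smul, norm_inv, Real.norm_natCast]
        refine mul_le_mul_of_nonneg_left ?_ (by positivity)
        refine (norm_sub_le _ _).trans ?_
        linarith [hterm N, hterm 0]
      refine squeeze_zero_norm hbound ?_
      simpa using (tendsto_inv_atTop_nhds_zero_nat (𝕜 := ℝ)).mul_const (2 * ‖w‖ * ‖w‖ * ‖x‖)
    exact sub_eq_zero.1 (tendsto_nhds_unique h1 h2)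
  have hcomm : ∀ (n : ℤ) x, U n (B x) = B (U n x) := by
    intro n
    induction n using Int.induction_on with
    | zero => intro x; rw [hU0, hU0]
    | succ i ih => intro x; rw [hU, hU, hcomm1, ih]
    | pred i ih =>
      intro x
      have h1 : x = U 1 (U (-1) x) := by rw [← hU]; simp [hU0]
      have h2 : ∀ y : H, U (-(i : ℤ) - 1) (U 1 y) = U (-i) y := fun y => by
        rw [← hU]; congr 2; ring
      rw [h1, ← hcomm1, h2, h2, ih]
  have hBw : B w ∈ almostPeriodic U := by
    rw [mem_almostPeriodic]
    refine ((hcomp.isCompact_closure_image_closedBall ‖w‖).totallyBounded).subset ?_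
    rintro _ ⟨n, rfl⟩
    refine subset_closure ⟨U n w, ?_, (hcomm n w).symm⟩
    simp [(U n).norm_map]
  have hzero : ⟪w, B w⟫_ℝ = 0 := hw _ hBw
  have hz0 : ‖z‖ ^ 2 = 0 := by
    rw [hz', ← hzero]
    have h1 := (tendsto_const_nhds (x := τ.tmul w w)).inner (𝕜 := ℝ) hz
    have h2 : Tendsto (fun N => ⟪w, frameAverage u N w⟫_ℝ) atTop (𝓝 ⟪w, B w⟫_ℝ) :=
      tendsto_const_nhds.inner (hBx w)
    refine tendsto_nhds_unique h1 (h2.congr fun N => ?_)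
    rw [τ.inner_frameAverage]
  have h3 := (hz.norm).pow 2
  rw [hz0] at h3
  refine h3.congr fun N => ?_
  rw [τ.norm_average_sq u N]

end HilbertSpace

section Koopman

open scoped InnerProductSpace Topology

variable {X : Type*} [MeasurableSpace X]

/-- A measure preserving action of `ℤ`. -/
structure IsMeasurePreservingAction (T : ℤ → X → X) (ν : Measure X) : Prop where
  measurePreserving : ∀ n, MeasurePreserving (T n) ν ν
  zero : T 0 = id
  add : ∀ m n, T (m + n) = T m ∘ T n

/-- A measurable function with values in `[-1, 1]`. -/
structure UnitBounded (f : X → ℝ) : Prop where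
  measurable : Measurable f
  abs_le : ∀ x, |f x| ≤ 1

namespace UnitBounded

variable {f g : X → ℝ} {ν : Measure X}

theorem mul (hf : UnitBounded f) (hg : UnitBounded g) : UnitBounded fun x => f x * g x :=
  ⟨hf.measurable.mul hg.measurable, fun x => by
    rw [abs_mul]
    exact mul_le_one₀ (hf.abs_le x) (abs_nonneg _) (hg.abs_le x)⟩

theorem comp (hf : UnitBounded f) {S : X → X} (hS : Measurable S) :
    UnitBounded fun x => f (S x) :=
  ⟨hf.measurable.comp hS, fun _ => hf.abs_le _⟩

theorem average {F : ℕ → X → ℝ} (hF : ∀ k, UnitBounded (F k)) (N : ℕ) :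
    UnitBounded fun x => (N : ℝ)⁻¹ * ∑ k ∈ Finset.range N, F k x := by
  refine ⟨(Finset.measurable_sum _ fun k _ => (hF k).measurable).const_mul _, fun x => ?_⟩
  rw [abs_mul, abs_inv, Nat.abs_cast]
  rcases N.eq_zero_or_pos with rfl | hN
  · simp
  · rw [inv_mul_le_one₀ (by positivity)]
    refine (Finset.abs_sum_le_sum_abs _ _).trans ?_
    simpa using Finset.sum_le_sum fun k (_ : k ∈ Finset.range N) => (hF k).abs_le x

theorem memLp [IsFiniteMeasure ν] (hf : UnitBounded f) : MemLp f 2 ν :=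
  MemLp.of_bound hf.measurable.aestronglyMeasurable 1 (Eventually.of_forall hf.abs_le)

theorem integrable [IsFiniteMeasure ν] (hf : UnitBounded f) : Integrable f ν :=
  Integrable.of_bound hf.measurable.aestronglyMeasurable 1 (Eventually.of_forall hf.abs_le)

theorem abs_integral_le [IsProbabilityMeasure ν] (hf : UnitBounded f) : |∫ x, f x ∂ν| ≤ 1 := by
  simpa using norm_integral_le_of_norm_le_const (μ := ν) (f := f) (C := 1)
    (Eventually.of_forall hf.abs_le)

end UnitBounded

variable {T : ℤ → X → X} {ν : Measure X}

/-- The Koopman representation of a measure preserving action of `ℤ`. -/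
noncomputable def koopman (h : IsMeasurePreservingAction T ν) (n : ℤ) :
    Lp ℝ 2 ν →ₗᵢ[ℝ] Lp ℝ 2 ν :=
  Lp.compMeasurePreservingₗᵢ ℝ (T n) (h.measurePreserving n)

theorem coeFn_koopman (h : IsMeasurePreservingAction T ν) (n : ℤ) (v : Lp ℝ 2 ν) :
    koopman h n v =ᵐ[ν] v ∘ T n :=
  Lp.coeFn_compMeasurePreserving v (h.measurePreserving n)

theorem koopman_zero (h : IsMeasurePreservingAction T ν) (v : Lp ℝ 2 ν) :
    koopman h 0 v = v := by
  refine Lp.ext ((coeFn_koopman h 0 v).trans ?_)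
  rw [h.zero]
  rfl

theorem koopman_add (h : IsMeasurePreservingAction T ν) (m n : ℤ) (v : Lp ℝ 2 ν) :
    koopman h (m + n) v = koopman h m (koopman h n v) := by
  refine Lp.ext ((coeFn_koopman h (m + n) v).trans ?_)
  refine EventuallyEq.trans ?_ (coeFn_koopman h m _).symm
  have := (h.measurePreserving m).quasiMeasurePreserving.ae_eq_comp (coeFn_koopman h n v)
  refine EventuallyEq.trans ?_ this.symm
  rw [add_comm, h.add]
  rfl

theorem norm_sq_eq_integral (v : Lp ℝ 2 ν) : ‖v‖ ^ 2 = ∫ x, v x ^ 2 ∂ν := by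
  rw [← real_inner_self_eq_norm_sq, L2.inner_def]
  simp [pow_two]

theorem inner_eq_integral (v w : Lp ℝ 2 ν) : ⟪v, w⟫_ℝ = ∫ x, v x * w x ∂ν := by
  rw [L2.inner_def]
  simp [mul_comm]

/-- The ergodic averages of a function. -/
noncomputable def ergodicAverage (T : ℤ → X → X) (g : X → ℝ) (N : ℕ) (x : X) : ℝ :=
  (N : ℝ)⁻¹ * ∑ k ∈ Finset.range N, g (T k x)

theorem UnitBounded.ergodicAverage {g : X → ℝ} (hg : UnitBounded g)
    (h : IsMeasurePreservingAction T ν) (N : ℕ) : UnitBounded (ergodicAverage T g N) :=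
  UnitBounded.average (fun k => hg.comp (h.measurePreserving k).measurable) N

theorem coeFn_sum_koopman (h : IsMeasurePreservingAction T ν) (v : Lp ℝ 2 ν) (N : ℕ) :
    ((N : ℝ)⁻¹ • ∑ k ∈ Finset.range N, koopman h k v : Lp ℝ 2 ν) =ᵐ[ν]
      ergodicAverage T v N := by
  have h1 : ∀ᵐ x ∂ν, ∀ k : ℕ, koopman h k v x = v (T k x) :=
    ae_all_iff.2 fun k => coeFn_koopman h k v
  have h2 : (∑ k ∈ Finset.range N, koopman h k v : Lp ℝ 2 ν) =ᵐ[ν]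
      fun x => ∑ k ∈ Finset.range N, koopman h k v x :=
    (Lp.coeFn_finsetSum _ _).trans (Eventually.of_forall fun x => Finset.sum_apply _ _ _)
  filter_upwards [h1, h2, Lp.coeFn_smul (N : ℝ)⁻¹ (∑ k ∈ Finset.range N, koopman h k v)]
    with x h1 h2 h3
  rw [h3, Pi.smul_apply, h2, ergodicAverage, smul_eq_mul]
  simp_rw [h1]

theorem ergodicAverage_congr (h : IsMeasurePreservingAction T ν) {f g : X → ℝ} (hfg : f =ᵐ[ν] g)
    (N : ℕ) : ergodicAverage T f N =ᵐ[ν] ergodicAverage T g N := by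
  have h1 : ∀ᵐ x ∂ν, ∀ k : ℕ, f (T k x) = g (T k x) :=
    ae_all_iff.2 fun k => (h.measurePreserving k).quasiMeasurePreserving.ae_eq_comp hfg
  filter_upwards [h1] with x h1
  simp [ergodicAverage, h1]

/-- The mean ergodic theorem for bounded functions. -/
theorem exists_tendsto_ergodicAverage [IsFiniteMeasure ν] (h : IsMeasurePreservingAction T ν)
    {g : X → ℝ} (hg : UnitBounded g) :
    ∃ z : Lp ℝ 2 ν, z ∘ T 1 =ᵐ[ν] z ∧
      (∀ y : Lp ℝ 2 ν, y ∘ T 1 =ᵐ[ν] y → ∫ x, g x * y x ∂ν = ∫ x, z x * y x ∂ν) ∧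
      Tendsto (fun N => ∫ x, (ergodicAverage T g N x - z x) ^ 2 ∂ν) atTop (𝓝 0) ∧
      Tendsto (fun N => ∫ x, ergodicAverage T g N x ^ 2 ∂ν) atTop (𝓝 (∫ x, z x ^ 2 ∂ν)) := by
  have hfix : ∀ y : Lp ℝ 2 ν, koopman h 1 y = y ↔ y ∘ T 1 =ᵐ[ν] y := fun y => by
    refine ⟨fun hy => ?_, fun hy => Lp.ext ((coeFn_koopman h 1 y).trans hy)⟩
    have := coeFn_koopman h 1 y
    rw [hy] at this
    exact this.symm
  obtain ⟨z, hz, hz', hlim⟩ := exists_tendsto_cesaro (koopman h 1).toContinuousLinearMap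
    (koopman h 1).norm_toContinuousLinearMap_le (hg.memLp (ν := ν)).toLp
  have h2 : ∀ k : ℕ, ((koopman h 1).toContinuousLinearMap ^ k) hg.memLp.toLp =
      koopman h k (hg.memLp (ν := ν)).toLp := fun k => by
    rw [← pow_apply_eq (U := koopman h) (koopman_zero h) (koopman_add h)]
    induction k with
    | zero => rfl
    | succ k ih =>
      rw [pow_succ', pow_succ', mul_apply_eq_comp, ih]
      rfl
  simp_rw [h2] at hlim
  have hae : ∀ N : ℕ, ((N : ℝ)⁻¹ • ∑ k ∈ Finset.range N, koopman h k (hg.memLp (ν := ν)).toLp :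
      Lp ℝ 2 ν) =ᵐ[ν] ergodicAverage T g N := fun N =>
    (coeFn_sum_koopman h _ N).trans (ergodicAverage_congr h hg.memLp.coeFn_toLp N)
  refine ⟨z, (hfix z).1 hz, fun y hy => ?_, ?_, ?_⟩
  · have := hz' y ((hfix y).2 hy)
    rw [inner_sub_left, sub_eq_zero, inner_eq_integral, inner_eq_integral] at this
    rw [← this]
    refine integral_congr_ae ?_
    filter_upwards [hg.memLp.coeFn_toLp (μ := ν)] with x hx
    rw [hx]
  · have h1 := ((tendsto_sub_nhds_zero_iff.2 hlim).norm).pow 2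
    simp only [norm_zero, ne_eq, OfNat.ofNat_ne_zero, not_false_eq_true, zero_pow] at h1
    refine h1.congr fun N => ?_
    rw [norm_sq_eq_integral]
    refine integral_congr_ae ?_
    filter_upwards [Lp.coeFn_sub ((N : ℝ)⁻¹ • ∑ k ∈ Finset.range N, koopman h k
      (hg.memLp (ν := ν)).toLp) z, hae N] with x h3 h4
    rw [h3, Pi.sub_apply, h4]
  · rw [← norm_sq_eq_integral]
    refine (hlim.norm.pow 2).congr fun N => ?_
    rw [norm_sq_eq_integral]
    refine integral_congr_ae ?_
    filter_upwards [hae N] with x h4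
    rw [h4]

theorem tendsto_ergodicAverage_of_ergodic [IsProbabilityMeasure ν]
    (h : IsMeasurePreservingAction T ν) (he : Ergodic (T 1) ν) {g : X → ℝ} (hg : UnitBounded g) :
    Tendsto (fun N => ∫ x, (ergodicAverage T g N x - ∫ y, g y ∂ν) ^ 2 ∂ν) atTop (𝓝 0) := by
  obtain ⟨z, hz, hz', hlim, -⟩ := exists_tendsto_ergodicAverage h hg
  obtain ⟨c, hc⟩ := he.ae_eq_const_of_ae_eq_comp_ae (Lp.aestronglyMeasurable z) hz
  have h1 : MemLp (fun _ : X => (1 : ℝ)) 2 ν := memLp_const 1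
  have h2 := hz' (h1.toLp _) (by
    have := h1.coeFn_toLp
    exact ((h.measurePreserving 1).quasiMeasurePreserving.ae_eq_comp this).trans this.symm)
  have h3 : ∫ x, g x ∂ν = c := by
    have e1 : ∫ x, g x * h1.toLp _ x ∂ν = ∫ x, g x ∂ν := by
      refine integral_congr_ae ?_
      filter_upwards [h1.coeFn_toLp] with x hx
      rw [hx, mul_one]
    have e2 : ∫ x, z x * h1.toLp _ x ∂ν = ∫ x, c ∂ν := by
      refine integral_congr_ae ?_
      filter_upwards [h1.coeFn_toLp, hc] with x hx hcx
      rw [hx, mul_one, hcx]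
      rfl
    rw [← e1, h2, e2]
    simp
  refine hlim.congr fun N => integral_congr_ae ?_
  filter_upwards [hc] with x hcx
  rw [h3, hcx]
  rfl

end Koopman

section Averages

open scoped Topology

variable {X : Type*} [MeasurableSpace X] {T : ℤ → X → X} {ν : Measure X}

theorem IsMeasurePreservingAction.integral_comp (h : IsMeasurePreservingAction T ν) (n : ℤ)
    {G : X → ℝ} (hG : Measurable G) : ∫ x, G (T n x) ∂ν = ∫ x, G x ∂ν := by
  conv_rhs => rw [← (h.measurePreserving n).map_eq]
  rw [integral_map (h.measurePreserving n).aemeasurable hG.aestronglyMeasurable]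

theorem IsMeasurePreservingAction.apply_add (h : IsMeasurePreservingAction T ν) (m n : ℤ) (x : X) :
    T (m + n) x = T m (T n x) := by
  rw [h.add]; rfl

theorem UnitBounded.sq_integral_mul_le [IsProbabilityMeasure ν] {u F : X → ℝ}
    (hu : UnitBounded u) (hF : MemLp F 2 ν) :
    (∫ x, u x * F x ∂ν) ^ 2 ≤ ∫ x, F x ^ 2 ∂ν := by
  have hle : ∀ x, |u x * F x| ≤ |F x| := fun x => by
    rw [abs_mul]
    exact mul_le_of_le_one_left (abs_nonneg _) (hu.abs_le x)
  have hm : MemLp (fun x => u x * F x) 2 ν :=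
    hF.mono (hu.measurable.aestronglyMeasurable.mul hF.1) (Eventually.of_forall hle)
  have h1 := ProbabilityTheory.variance_nonneg (fun x => u x * F x) ν
  rw [ProbabilityTheory.variance_eq_sub hm] at h1
  have h2 : ∫ x, (u x * F x) ^ 2 ∂ν ≤ ∫ x, F x ^ 2 ∂ν :=
    integral_mono hm.integrable_sq hF.integrable_sq fun x => sq_le_sq.2 (hle x)
  simp only [Pi.pow_apply] at h1
  linarith

/-- Uniformity in the starting point and in the test function of the mean ergodic theorem. -/
theorem eventually_abs_average_sub_le [IsProbabilityMeasure ν]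
    (h : IsMeasurePreservingAction T ν) (he : Ergodic (T 1) ν) {g : X → ℝ} (hg : UnitBounded g)
    {ε : ℝ} (hε : 0 < ε) :
    ∀ᶠ L : ℕ in atTop, ∀ a : ℤ, ∀ u : X → ℝ, UnitBounded u →
      |(L : ℝ)⁻¹ * ∑ k ∈ Finset.range L, ∫ x, u x * g (T (a + k) x) ∂ν -
        (∫ x, u x ∂ν) * ∫ x, g x ∂ν| ≤ ε := by
  filter_upwards [(tendsto_ergodicAverage_of_ergodic h he hg).eventually_le_const
    (pow_pos hε 2)] with L hL a u hu
  refine abs_le_of_sq_le_sq ?_ hε.le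
  refine le_trans ?_ hL
  set c := ∫ y, g y ∂ν
  have hG : Measurable fun x => ergodicAverage T g L x - c :=
    (hg.ergodicAverage h L).measurable.sub_const c
  have hGm : MemLp (fun x => ergodicAverage T g L x - c) 2 ν :=
    (hg.ergodicAverage h L).memLp.sub (memLp_const c)
  rw [← h.integral_comp a (hG.pow_const 2)]
  refine le_trans (le_of_eq ?_)
    (hu.sq_integral_mul_le (hGm.comp_measurePreserving (h.measurePreserving a)))
  congr 1
  have hInt : ∀ k : ℕ, Integrable (fun x => u x * g (T (a + k) x)) ν := fun k =>
    (hu.mul (hg.comp (h.measurePreserving (a + k)).measurable)).integrable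
  have hsum : Integrable (fun x => (L : ℝ)⁻¹ * ∑ k ∈ Finset.range L, u x * g (T (a + k) x)) ν :=
    (integrable_finsetSum _ fun k _ => hInt k).const_mul _
  rw [← integral_finsetSum _ fun k _ => hInt k, ← integral_const_mul, ← integral_mul_const,
    ← integral_sub hsum (hu.integrable.mul_const c)]
  congr 1
  ext x
  simp only [ergodicAverage, mul_sub]
  rw [← Finset.mul_sum]
  simp_rw [← h.apply_add, add_comm]
  ring

end Averages

section Averages

open scoped Topology

variable {X : Type*} [MeasurableSpace X] {T : ℤ → X → X} {ν : Measure X}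

/-- The correlations of four functions along the parallelograms `(0, n, m, n + m)`. -/
noncomputable def correlation (T : ℤ → X → X) (ν : Measure X) (g₀ g₁ g₂ g₃ : X → ℝ) (n m : ℤ) :
    ℝ :=
  ∫ x, g₀ x * g₁ (T n x) * (g₂ (T m x) * g₃ (T (n + m) x)) ∂ν

/-- The average of `F` over `[a, a + L') × [b, b + L)`. -/
noncomputable def windowAverage (L L' : ℕ) (F : ℤ → ℤ → ℝ) (a b : ℤ) : ℝ :=
  (L' : ℝ)⁻¹ * ∑ k ∈ Finset.range L', ((L : ℝ)⁻¹ * ∑ l ∈ Finset.range L, F (a + k) (b + l))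

theorem sq_average_le (x : ℕ → ℝ) (N : ℕ) :
    ((N : ℝ)⁻¹ * ∑ k ∈ Finset.range N, x k) ^ 2 ≤
      (N : ℝ)⁻¹ * ∑ k ∈ Finset.range N, x k ^ 2 := by
  rcases N.eq_zero_or_pos with rfl | hN
  · simp
  · have h := sq_sum_le_card_mul_sum_sq (s := Finset.range N) (f := x)
    rw [Finset.card_range] at h
    have hN' : (0 : ℝ) < N := by positivity
    calc _ = (N : ℝ)⁻¹ * (N : ℝ)⁻¹ * (∑ k ∈ Finset.range N, x k) ^ 2 := by ring
      _ ≤ (N : ℝ)⁻¹ * (N : ℝ)⁻¹ * (N * ∑ k ∈ Finset.range N, x k ^ 2) := by gcongr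
      _ = _ := by field_simp

theorem sq_corner_average_le [IsProbabilityMeasure ν] (h : IsMeasurePreservingAction T ν)
    {g₀ g₁ g₂ w : X → ℝ} (h₀ : UnitBounded g₀) (h₁ : UnitBounded g₁) (h₂ : UnitBounded g₂)
    (hw : UnitBounded w) (L : ℕ) (n b : ℤ) :
    ((L : ℝ)⁻¹ * ∑ l ∈ Finset.range L, correlation T ν g₀ g₁ g₂ w n (b + l)) ^ 2 ≤
      (L : ℝ)⁻¹ * ∑ l ∈ Finset.range L, ((L : ℝ)⁻¹ * ∑ l' ∈ Finset.range L,
        ∫ x, (g₂ (T l x) * g₂ (T l' x)) * (w (T l (T n x)) * w (T l' (T n x))) ∂ν) := by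
  have hT := fun k => (h.measurePreserving k).measurable
  set G : X → ℝ := fun x => (L : ℝ)⁻¹ * ∑ l ∈ Finset.range L, g₂ (T l x) * w (T l (T n x))
    with hGdef
  have hG : UnitBounded G :=
    UnitBounded.average (fun l => (h₂.comp (hT l)).mul ((hw.comp (hT l)).comp (hT n))) L
  have e1 : (L : ℝ)⁻¹ * ∑ l ∈ Finset.range L, correlation T ν g₀ g₁ g₂ w n (b + l) =
      ∫ x, (g₀ x * g₁ (T n x)) * G (T b x) ∂ν := by
    simp only [correlation]
    rw [← integral_finsetSum (Finset.range L) fun l _ => ((h₀.mul (h₁.comp (hT n))).mul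
      ((h₂.comp (hT (b + l))).mul (hw.comp (hT (n + (b + l)))))).integrable, ← integral_const_mul]
    congr 1
    ext x
    simp only [hGdef]
    rw [mul_left_comm, Finset.mul_sum, Finset.mul_sum, Finset.mul_sum]
    refine Finset.sum_congr rfl fun l _ => ?_
    rw [← h.apply_add, ← h.apply_add, ← h.apply_add, add_comm b l,
      show (l : ℤ) + n + b = n + (l + b) by ring]
  rw [e1]
  refine ((h₀.mul (h₁.comp (hT n))).sq_integral_mul_le (hG.comp (hT b)).memLp).trans ?_
  rw [h.integral_comp b (hG.measurable.pow_const 2)]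
  refine le_of_eq ?_
  have hi : ∀ l l' : ℕ, Integrable (fun x =>
      (g₂ (T l x) * g₂ (T l' x)) * (w (T l (T n x)) * w (T l' (T n x)))) ν := fun l l' =>
    (((h₂.comp (hT l)).mul (h₂.comp (hT l'))).mul
      (((hw.comp (hT l)).comp (hT n)).mul ((hw.comp (hT l')).comp (hT n)))).integrable
  have e2 : ∀ l : ℕ, (L : ℝ)⁻¹ * ∑ l' ∈ Finset.range L,
        ∫ x, (g₂ (T l x) * g₂ (T l' x)) * (w (T l (T n x)) * w (T l' (T n x))) ∂ν =
      ∫ x, (L : ℝ)⁻¹ * ∑ l' ∈ Finset.range L,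
        (g₂ (T l x) * g₂ (T l' x)) * (w (T l (T n x)) * w (T l' (T n x))) ∂ν := fun l => by
    rw [← integral_finsetSum _ fun l' _ => hi l l', ← integral_const_mul]
  simp_rw [e2]
  rw [← integral_finsetSum _ fun l _ => (integrable_finsetSum _ fun l' _ => hi l l').const_mul _,
    ← integral_const_mul]
  congr 1
  ext x
  rw [hGdef]
  simp only
  rw [mul_pow, pow_two (∑ l ∈ _, _), Finset.sum_mul_sum, ← Finset.mul_sum, ← mul_assoc, ← pow_two]
  congr 1
  refine Finset.sum_congr rfl fun l _ => Finset.sum_congr rfl fun l' _ => ?_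
  ring

/-- A function orthogonal to the almost periodic functions has vanishing average correlations. -/
def WeaklyMixing (T : ℤ → X → X) (ν : Measure X) (w : X → ℝ) : Prop :=
  Tendsto (fun N : ℕ => (N : ℝ)⁻¹ * ∑ k ∈ Finset.range N, ((N : ℝ)⁻¹ *
    ∑ l ∈ Finset.range N, (∫ x, w (T k x) * w (T l x) ∂ν) ^ 2)) atTop (𝓝 0)

theorem average_const {N : ℕ} (hN : 0 < N) (c : ℝ) :
    (N : ℝ)⁻¹ * ∑ _k ∈ Finset.range N, c = c := by
  have : (N : ℝ) ≠ 0 := by positivity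
  simp [this]

theorem average_mono {x y : ℕ → ℝ} {N : ℕ} (h : ∀ k < N, x k ≤ y k) :
    (N : ℝ)⁻¹ * ∑ k ∈ Finset.range N, x k ≤ (N : ℝ)⁻¹ * ∑ k ∈ Finset.range N, y k :=
  mul_le_mul_of_nonneg_left (Finset.sum_le_sum fun k hk => h k (Finset.mem_range.1 hk))
    (by positivity)

theorem average_comm (F : ℕ → ℕ → ℝ) (M N : ℕ) :
    (M : ℝ)⁻¹ * ∑ k ∈ Finset.range M, ((N : ℝ)⁻¹ * ∑ l ∈ Finset.range N, F k l) =
      (N : ℝ)⁻¹ * ∑ l ∈ Finset.range N, ((M : ℝ)⁻¹ * ∑ k ∈ Finset.range M, F k l) := by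
  rw [← Finset.mul_sum, ← Finset.mul_sum, Finset.sum_comm]
  ring

theorem average_add (x y : ℕ → ℝ) (N : ℕ) :
    (N : ℝ)⁻¹ * ∑ k ∈ Finset.range N, (x k + y k) =
      (N : ℝ)⁻¹ * ∑ k ∈ Finset.range N, x k + (N : ℝ)⁻¹ * ∑ k ∈ Finset.range N, y k := by
  rw [Finset.sum_add_distrib, mul_add]

theorem average_mul (c : ℝ) (x : ℕ → ℝ) (N : ℕ) :
    (N : ℝ)⁻¹ * ∑ k ∈ Finset.range N, c * x k = c * ((N : ℝ)⁻¹ * ∑ k ∈ Finset.range N, x k) := by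
  rw [← Finset.mul_sum]
  ring

theorem WeaklyMixing.eventually_abs_windowAverage_le [IsProbabilityMeasure ν]
    (h : IsMeasurePreservingAction T ν) (he : Ergodic (T 1) ν)
    {g₀ g₁ g₂ w : X → ℝ} (h₀ : UnitBounded g₀) (h₁ : UnitBounded g₁) (h₂ : UnitBounded g₂)
    (hw : UnitBounded w) (hmix : WeaklyMixing T ν w) {ε : ℝ} (hε : 0 < ε) :
    ∀ᶠ L : ℕ in atTop, ∀ᶠ L' : ℕ in atTop, ∀ a b : ℤ,
      |windowAverage L L' (correlation T ν g₀ g₁ g₂ w) a b| ≤ ε := by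
  have hT := fun k => (h.measurePreserving k).measurable
  set δ : ℝ := ε ^ 2 / 3 with hδ
  have hδ0 : 0 < δ := by positivity
  filter_upwards [hmix.eventually_le_const (pow_pos hδ0 2), eventually_gt_atTop 0] with L hL hL0
  have hev : ∀ᶠ L' : ℕ in atTop, ∀ l ∈ Finset.range L, ∀ l' ∈ Finset.range L,
      ∀ a : ℤ, ∀ u : X → ℝ, UnitBounded u →
      |(L' : ℝ)⁻¹ * ∑ k ∈ Finset.range L', ∫ x, u x * (w (T l (T (a + k) x)) *
        w (T l' (T (a + k) x))) ∂ν - (∫ x, u x ∂ν) * ∫ x, w (T l x) * w (T l' x) ∂ν| ≤ δ :=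
    (Finset.eventually_all _).2 fun l _ => (Finset.eventually_all _).2 fun l' _ =>
      eventually_abs_average_sub_le h he ((hw.comp (hT l)).mul (hw.comp (hT l'))) hδ0
  filter_upwards [hev] with L' hL' a b
  refine abs_le_of_sq_le_sq ?_ hε.le
  refine (sq_average_le _ _).trans ?_
  refine (average_mono fun k _ => sq_corner_average_le h h₀ h₁ h₂ hw L (a + k) b).trans ?_
  rw [average_comm]
  simp_rw [average_comm (M := L') (N := L)]
  have hterm : ∀ l < L, ∀ l' < L, (L' : ℝ)⁻¹ * ∑ k ∈ Finset.range L',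
      ∫ x, (g₂ (T l x) * g₂ (T l' x)) * (w (T l (T (a + k) x)) * w (T l' (T (a + k) x))) ∂ν ≤
      2 * δ + δ⁻¹ * (∫ x, w (T l x) * w (T l' x) ∂ν) ^ 2 := by
    intro l hl l' hl'
    have hu := (h₂.comp (hT l)).mul (h₂.comp (hT l'))
    have h3 := (abs_le.1 (hL' l (Finset.mem_range.2 hl) l' (Finset.mem_range.2 hl') a _ hu)).2
    set t := ∫ x, w (T l x) * w (T l' x) ∂ν
    have h4 : (∫ x, g₂ (T l x) * g₂ (T l' x) ∂ν) * t ≤ |t| := by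
      refine (le_abs_self _).trans ?_
      rw [abs_mul]
      exact mul_le_of_le_one_left (abs_nonneg _) hu.abs_integral_le
    have h5 : |t| ≤ δ + δ⁻¹ * t ^ 2 := by
      have h6 : δ * δ⁻¹ = 1 := mul_inv_cancel₀ hδ0.ne'
      have h7 : 0 < δ⁻¹ := by positivity
      rw [← sq_abs t]
      nlinarith [mul_nonneg h7.le (sq_nonneg (|t| - δ)), abs_nonneg t]
    linarith
  refine (average_mono fun l hl => average_mono (hterm l hl)).trans ?_
  simp_rw [average_add, average_mul δ⁻¹, average_const hL0]
  have h6 : δ⁻¹ * (δ ^ 2) = δ := by field_simp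
  have h7 : 0 < δ⁻¹ := by positivity
  have h8 := mul_le_mul_of_nonneg_left hL h7.le
  rw [h6] at h8
  rw [hδ] at h8 ⊢
  linarith

end Averages

section Averages

open scoped Topology

variable {X : Type*} [MeasurableSpace X] {T : ℤ → X → X} {ν : Measure X}

theorem windowAverage_neg_left (L L' : ℕ) (F : ℤ → ℤ → ℝ) (a b : ℤ) :
    windowAverage L L' (fun n m => F (-n) m) a b = windowAverage L L' F (1 - a - L') b := by
  simp only [windowAverage]
  rw [← Finset.sum_range_reflect]
  congr 1
  refine Finset.sum_congr rfl fun k hk => ?_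
  have hk' := Finset.mem_range.1 hk
  have : -(a + ((L' - 1 - k : ℕ) : ℤ)) = 1 - a - L' + k := by omega
  rw [this]

theorem windowAverage_neg_right (L L' : ℕ) (F : ℤ → ℤ → ℝ) (a b : ℤ) :
    windowAverage L L' (fun n m => F n (-m)) a b = windowAverage L L' F a (1 - b - L) := by
  simp only [windowAverage]
  congr 1
  refine Finset.sum_congr rfl fun k _ => ?_
  rw [← Finset.sum_range_reflect]
  congr 1
  refine Finset.sum_congr rfl fun l hl => ?_
  have hl' := Finset.mem_range.1 hl
  have : -(b + ((L - 1 - l : ℕ) : ℤ)) = 1 - b - L + l := by omega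
  rw [this]

theorem windowAverage_add (L L' : ℕ) (F G : ℤ → ℤ → ℝ) (a b : ℤ) :
    windowAverage L L' (fun n m => F n m + G n m) a b =
      windowAverage L L' F a b + windowAverage L L' G a b := by
  simp only [windowAverage, average_add]

/-- The averages of `F` over long windows are uniformly small. -/
def SmallOnAverage (F : ℤ → ℤ → ℝ) : Prop :=
  ∀ ε > 0, ∀ᶠ L : ℕ in atTop, ∀ᶠ L' : ℕ in atTop, ∀ a b : ℤ, |windowAverage L L' F a b| ≤ ε

namespace SmallOnAverage

variable {F G : ℤ → ℤ → ℝ}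

theorem add (hF : SmallOnAverage F) (hG : SmallOnAverage G) :
    SmallOnAverage fun n m => F n m + G n m := by
  intro ε hε
  filter_upwards [hF (ε / 2) (half_pos hε), hG (ε / 2) (half_pos hε)] with L h1 h2
  filter_upwards [h1, h2] with L' h1 h2 a b
  rw [windowAverage_add]
  linarith [abs_add_le (windowAverage L L' F a b) (windowAverage L L' G a b), h1 a b, h2 a b]

theorem neg_left (hF : SmallOnAverage F) : SmallOnAverage fun n m => F (-n) m := by
  intro ε hε
  filter_upwards [hF ε hε] with L h1
  filter_upwards [h1] with L' h1 a b
  rw [windowAverage_neg_left]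
  exact h1 _ _

theorem neg_right (hF : SmallOnAverage F) : SmallOnAverage fun n m => F n (-m) := by
  intro ε hε
  filter_upwards [hF ε hε] with L h1
  filter_upwards [h1] with L' h1 a b
  rw [windowAverage_neg_right]
  exact h1 _ _

end SmallOnAverage

theorem correlation_neg_right (h : IsMeasurePreservingAction T ν) {g₀ g₁ g₂ g₃ : X → ℝ}
    (h₀ : UnitBounded g₀) (h₁ : UnitBounded g₁) (h₂ : UnitBounded g₂) (h₃ : UnitBounded g₃)
    (n m : ℤ) : correlation T ν g₀ g₁ g₂ g₃ n m = correlation T ν g₂ g₃ g₀ g₁ n (-m) := by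
  have hT := fun k => (h.measurePreserving k).measurable
  simp only [correlation]
  rw [← h.integral_comp m (((h₂.mul (h₃.comp (hT n))).mul ((h₀.comp (hT (-m))).mul
    (h₁.comp (hT (n + -m))))).measurable)]
  congr 1
  ext x
  simp only [← h.apply_add]
  rw [neg_add_cancel, neg_add_cancel_right, h.zero]
  simp only [id]
  ring

theorem correlation_neg_left (h : IsMeasurePreservingAction T ν) {g₀ g₁ g₂ g₃ : X → ℝ}
    (h₀ : UnitBounded g₀) (h₁ : UnitBounded g₁) (h₂ : UnitBounded g₂) (h₃ : UnitBounded g₃)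
    (n m : ℤ) : correlation T ν g₀ g₁ g₂ g₃ n m = correlation T ν g₁ g₀ g₃ g₂ (-n) m := by
  have hT := fun k => (h.measurePreserving k).measurable
  simp only [correlation]
  rw [← h.integral_comp n (((h₁.mul (h₀.comp (hT (-n)))).mul ((h₃.comp (hT m)).mul
    (h₂.comp (hT (-n + m))))).measurable)]
  congr 1
  ext x
  simp only [← h.apply_add]
  rw [neg_add_cancel, show -n + m + n = m by ring, add_comm m n, h.zero]
  simp only [id]
  ring

namespace WeaklyMixing

variable [IsProbabilityMeasure ν] {g₀ g₁ g₂ w : X → ℝ}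

theorem smallOnAverage₃ (hmix : WeaklyMixing T ν w) (h : IsMeasurePreservingAction T ν)
    (he : Ergodic (T 1) ν) (h₀ : UnitBounded g₀) (h₁ : UnitBounded g₁) (h₂ : UnitBounded g₂)
    (hw : UnitBounded w) : SmallOnAverage (correlation T ν g₀ g₁ g₂ w) :=
  fun _ hε => hmix.eventually_abs_windowAverage_le h he h₀ h₁ h₂ hw hε

theorem smallOnAverage₂ (hmix : WeaklyMixing T ν w) (h : IsMeasurePreservingAction T ν)
    (he : Ergodic (T 1) ν) (h₀ : UnitBounded g₀) (h₁ : UnitBounded g₁) (h₂ : UnitBounded g₂)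
    (hw : UnitBounded w) : SmallOnAverage (correlation T ν g₀ g₁ w g₂) := by
  have := (hmix.smallOnAverage₃ h he h₁ h₀ h₂ hw).neg_left
  simpa only [← correlation_neg_left h h₀ h₁ hw h₂] using this

theorem smallOnAverage₁ (hmix : WeaklyMixing T ν w) (h : IsMeasurePreservingAction T ν)
    (he : Ergodic (T 1) ν) (h₀ : UnitBounded g₀) (h₁ : UnitBounded g₁) (h₂ : UnitBounded g₂)
    (hw : UnitBounded w) : SmallOnAverage (correlation T ν g₀ w g₁ g₂) := by
  have := (hmix.smallOnAverage₃ h he h₁ h₂ h₀ hw).neg_right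
  simpa only [← correlation_neg_right h h₀ hw h₁ h₂] using this

theorem smallOnAverage₀ (hmix : WeaklyMixing T ν w) (h : IsMeasurePreservingAction T ν)
    (he : Ergodic (T 1) ν) (h₀ : UnitBounded g₀) (h₁ : UnitBounded g₁) (h₂ : UnitBounded g₂)
    (hw : UnitBounded w) : SmallOnAverage (correlation T ν w g₀ g₁ g₂) := by
  have := (hmix.smallOnAverage₂ h he h₁ h₂ h₀ hw).neg_right
  simpa only [← correlation_neg_right h hw h₀ h₁ h₂] using this

/-- Replacing a function by another one with weakly mixing difference does not affect the
averages of the correlations. -/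
theorem smallOnAverage_sub {f φ : X → ℝ} (hmix : WeaklyMixing T ν fun x => f x - φ x)
    (h : IsMeasurePreservingAction T ν) (he : Ergodic (T 1) ν) (hf : UnitBounded f)
    (hφ : UnitBounded φ) (hw : UnitBounded fun x => f x - φ x) :
    SmallOnAverage fun n m => correlation T ν f f f f n m - correlation T ν φ φ φ φ n m := by
  have hT := fun k => (h.measurePreserving k).measurable
  have h4 := (((hmix.smallOnAverage₃ h he hf hf hf hw).add
    (hmix.smallOnAverage₂ h he hf hf hφ hw)).add (hmix.smallOnAverage₁ h he hf hφ hφ hw)).add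
    (hmix.smallOnAverage₀ h he hφ hφ hφ hw)
  convert h4 using 3 with n m
  have hi : ∀ {g₀ g₁ g₂ g₃ : X → ℝ}, UnitBounded g₀ → UnitBounded g₁ → UnitBounded g₂ →
      UnitBounded g₃ →
      Integrable (fun x => g₀ x * g₁ (T n x) * (g₂ (T m x) * g₃ (T (n + m) x))) ν :=
    fun h₀ h₁ h₂ h₃ => ((h₀.mul (h₁.comp (hT _))).mul ((h₂.comp (hT _)).mul
      (h₃.comp (hT _)))).integrable
  have hadd : ∀ {G₁ G₂ : X → ℝ}, Integrable G₁ ν → Integrable G₂ ν →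
      Integrable (fun x => G₁ x + G₂ x) ν := fun h₁ h₂ => h₁.add h₂
  simp only [correlation]
  rw [← integral_sub (hi hf hf hf hf) (hi hφ hφ hφ hφ),
    ← integral_add (hi hf hf hf hw) (hi hf hf hw hφ),
    ← integral_add (hadd (hi hf hf hf hw) (hi hf hf hw hφ)) (hi hf hw hφ hφ),
    ← integral_add (hadd (hadd (hi hf hf hf hw) (hi hf hf hw hφ)) (hi hf hw hφ hφ))
      (hi hw hφ hφ hφ)]
  congr 1
  ext x
  ring

end WeaklyMixing

theorem UnitBounded.abs_integral_mul_le [IsProbabilityMeasure ν] {u F : X → ℝ}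
    (hu : UnitBounded u) (hF : Integrable F ν) :
    |∫ x, u x * F x ∂ν| ≤ ∫ x, |F x| ∂ν := by
  refine abs_integral_le_integral_abs.trans (integral_mono_of_nonneg
    (Eventually.of_forall fun x => abs_nonneg _) hF.abs (Eventually.of_forall fun x => ?_))
  simp only [abs_mul]
  exact mul_le_of_le_one_left (abs_nonneg _) (hu.abs_le x)

/-- The orbit of `φ` is totally bounded in `L¹`. -/
def IsCompactFunction (T : ℤ → X → X) (ν : Measure X) (φ : X → ℝ) : Prop :=
  ∀ ε > 0, ∃ s : Finset ℤ, ∀ n, ∃ j ∈ s, ∫ x, |φ (T n x) - φ (T j x)| ∂ν ≤ ε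

theorem IsCompactFunction.eventually_le_windowAverage [IsProbabilityMeasure ν] {φ : X → ℝ}
    (hc : IsCompactFunction T ν φ) (h : IsMeasurePreservingAction T ν) (he : Ergodic (T 1) ν)
    (hφ : UnitBounded φ) {ε : ℝ} (hε : 0 < ε) :
    ∀ᶠ L : ℕ in atTop, ∀ᶠ L' : ℕ in atTop, ∀ a b : ℤ,
      (∫ x, φ x ∂ν) ^ 4 - ε ≤ windowAverage L L' (correlation T ν φ φ φ φ) a b := by
  have hT := fun k => (h.measurePreserving k).measurable
  set δ : ℝ := ε / 5 with hδ
  have hδ0 : 0 < δ := by positivity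
  obtain ⟨s, hs⟩ := hc δ hδ0
  have hv : ∀ n, UnitBounded fun x => φ x * φ (T n x) := fun n => hφ.mul (hφ.comp (hT n))
  have hev : ∀ᶠ L : ℕ in atTop, ∀ j ∈ s, ∀ b : ℤ, ∀ u : X → ℝ, UnitBounded u →
      |(L : ℝ)⁻¹ * ∑ l ∈ Finset.range L, ∫ x, u x * (φ (T (b + l) x) * φ (T j (T (b + l) x))) ∂ν -
        (∫ x, u x ∂ν) * ∫ x, φ x * φ (T j x) ∂ν| ≤ δ :=
    (Finset.eventually_all _).2 fun j _ => eventually_abs_average_sub_le h he (hv j) hδ0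
  filter_upwards [hev, eventually_gt_atTop 0] with L hL hL0
  filter_upwards [eventually_abs_average_sub_le h he hφ hδ0, eventually_gt_atTop 0]
    with L' hL' hL0' a b
  have hinner : ∀ n : ℤ, (∫ x, φ x * φ (T n x) ∂ν) ^ 2 + -(3 * δ) ≤
      (L : ℝ)⁻¹ * ∑ l ∈ Finset.range L, correlation T ν φ φ φ φ n (b + l) := by
    intro n
    obtain ⟨j, hj, hnj⟩ := hs n
    have hd : Integrable (fun x => φ (T n x) - φ (T j x)) ν :=
      (hφ.comp (hT n)).integrable.sub (hφ.comp (hT j)).integrable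
    have h1 : |∫ x, φ x * φ (T n x) ∂ν - ∫ x, φ x * φ (T j x) ∂ν| ≤ δ := by
      rw [← integral_sub (hv n).integrable (hv j).integrable]
      simp_rw [← mul_sub]
      exact (hφ.abs_integral_mul_le hd).trans hnj
    have h2 : ∀ m : ℤ, ∫ x, φ x * φ (T n x) * (φ (T m x) * φ (T j (T m x))) ∂ν + -δ ≤
        correlation T ν φ φ φ φ n m := by
      intro m
      have hd' : Integrable (fun x => φ (T n (T m x)) - φ (T j (T m x))) ν :=
        ((hφ.comp (hT n)).comp (hT m)).integrable.sub ((hφ.comp (hT j)).comp (hT m)).integrable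
      have h3 := ((hv n).mul (hφ.comp (hT m))).abs_integral_mul_le hd'
      have hm : Measurable fun x => |φ (T n x) - φ (T j x)| :=
        ((hφ.comp (hT n)).measurable.sub (hφ.comp (hT j)).measurable).abs
      rw [h.integral_comp m hm] at h3
      have h4 := (abs_le.1 (h3.trans hnj)).1
      have h5 : ∫ x, φ x * φ (T n x) * φ (T m x) * (φ (T n (T m x)) - φ (T j (T m x))) ∂ν =
          correlation T ν φ φ φ φ n m -
            ∫ x, φ x * φ (T n x) * (φ (T m x) * φ (T j (T m x))) ∂ν := by
        rw [correlation, ← integral_sub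
          ((hv n).mul ((hφ.comp (hT m)).mul (hφ.comp (hT (n + m))))).integrable
          ((hv n).mul ((hv j).comp (hT m))).integrable]
        congr 1
        ext x
        rw [h.apply_add]
        ring
      linarith
    have h6 := average_mono (N := L) fun l _ => h2 (b + l)
    rw [average_add, average_const hL0] at h6
    have h7 := (abs_le.1 (hL j hj b _ (hv n))).1
    have h8 := (abs_le.1 h1).2
    have h9 := (hv n).abs_integral_le (ν := ν)
    have h10 : (∫ x, φ x * φ (T n x) ∂ν) ^ 2 - δ ≤
        (∫ x, φ x * φ (T n x) ∂ν) * ∫ x, φ x * φ (T j x) ∂ν := by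
      have h11 := abs_mul (∫ x, φ x * φ (T n x) ∂ν)
        (∫ x, φ x * φ (T n x) ∂ν - ∫ x, φ x * φ (T j x) ∂ν)
      have h12 := mul_le_mul h9 h1 (abs_nonneg _) zero_le_one
      rw [← h11, one_mul] at h12
      linarith [(abs_le.1 h12).2]
    linarith
  have h13 := average_mono (N := L') fun k _ => hinner (a + k)
  rw [average_add, average_const hL0'] at h13
  have h14 := sq_average_le (fun k => ∫ x, φ x * φ (T (a + k) x) ∂ν) L'
  have h15 := (abs_le.1 (hL' a φ hφ)).1
  rw [windowAverage]
  refine le_trans ?_ h13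
  have h16 := abs_le.1 (hφ.abs_integral_le (ν := ν))
  set c := ∫ x, φ x ∂ν
  set A := (L' : ℝ)⁻¹ * ∑ k ∈ Finset.range L', ∫ x, φ x * φ (T (a + k) x) ∂ν
  have h17 : c ^ 2 ≤ 1 := by nlinarith
  have h18 : c ^ 4 - 2 * δ ≤ A ^ 2 := by
    nlinarith [sq_nonneg (A - c ^ 2), mul_le_mul_of_nonneg_right h17 hδ0.le,
      mul_le_mul_of_nonneg_left h15 (sq_nonneg c)]
  linarith

end Averages

section CompactPart

open scoped Topology InnerProductSpace

variable {X : Type*} [MeasurableSpace X] {T : ℤ → X → X} {ν : Measure X}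

theorem lipschitzWith_clamp : LipschitzWith 1 fun t : ℝ => max 0 (min 1 t) :=
  (LipschitzWith.id.const_min 1).const_max 0

theorem koopman_compLp (h : IsMeasurePreservingAction T ν) {g : ℝ → ℝ} {c : NNReal}
    (hg : LipschitzWith c g) (g0 : g 0 = 0) (n : ℤ) (v : Lp ℝ 2 ν) :
    koopman h n (hg.compLp g0 v) = hg.compLp g0 (koopman h n v) := by
  refine Lp.ext ((coeFn_koopman h n _).trans ?_)
  filter_upwards [(h.measurePreserving n).quasiMeasurePreserving.ae_eq_comp
    (hg.coeFn_compLp g0 v), hg.coeFn_compLp g0 (koopman h n v), coeFn_koopman h n v]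
    with x h1 h2 h3
  rw [h1, h2, Function.comp_apply, Function.comp_apply, Function.comp_apply, h3,
    Function.comp_apply]

theorem compLp_mem_almostPeriodic (h : IsMeasurePreservingAction T ν) {g : ℝ → ℝ} {c : NNReal}
    (hg : LipschitzWith c g) (g0 : g 0 = 0) {v : Lp ℝ 2 ν} (hv : v ∈ almostPeriodic (koopman h)) :
    hg.compLp g0 v ∈ almostPeriodic (koopman h) := by
  rw [mem_almostPeriodic] at hv ⊢
  refine (hv.image (hg.lipschitzWith_compLp g0).uniformContinuous).subset ?_
  rintro _ ⟨n, rfl⟩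
  exact ⟨_, ⟨n, rfl⟩, (koopman_compLp h hg g0 n v).symm⟩

theorem one_mem_almostPeriodic [IsFiniteMeasure ν] (h : IsMeasurePreservingAction T ν) :
    (memLp_const (1 : ℝ)).toLp (fun _ : X => (1 : ℝ)) ∈ almostPeriodic (koopman h) := by
  rw [mem_almostPeriodic]
  refine (Set.finite_singleton ((memLp_const (1 : ℝ)).toLp (fun _ : X => (1 : ℝ)))).totallyBounded
    |>.subset ?_
  rintro _ ⟨n, rfl⟩
  have := (memLp_const (p := 2) (μ := ν) (1 : ℝ)).coeFn_toLp
  exact Lp.ext ((coeFn_koopman h n _).trans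
    (((h.measurePreserving n).quasiMeasurePreserving.ae_eq_comp this).trans this.symm))

theorem sq_integral_abs_le [IsProbabilityMeasure ν] {F : X → ℝ} (hF : MemLp F 2 ν) :
    (∫ x, |F x| ∂ν) ^ 2 ≤ ∫ x, F x ^ 2 ∂ν := by
  have h1 : UnitBounded fun _ : X => (1 : ℝ) := ⟨measurable_const, by simp⟩
  simpa using h1.sq_integral_mul_le hF.abs

/-- Decomposition of a bounded function in a compact and a weakly mixing part. -/
theorem exists_compact_weaklyMixing_decomposition [IsProbabilityMeasure ν]
    (h : IsMeasurePreservingAction T ν) {f : X → ℝ} (hf : Measurable f)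
    (hf' : ∀ x, 0 ≤ f x ∧ f x ≤ 1) :
    ∃ φ : X → ℝ, Measurable φ ∧ (∀ x, 0 ≤ φ x ∧ φ x ≤ 1) ∧ ∫ x, φ x ∂ν = ∫ x, f x ∂ν ∧
      IsCompactFunction T ν φ ∧ WeaklyMixing T ν fun x => f x - φ x := by
  have hfu : UnitBounded f := ⟨hf, fun x => abs_le.2 ⟨by linarith [hf' x], (hf' x).2⟩⟩
  have hT := fun k => (h.measurePreserving k).measurable
  have hqmp := fun k => (h.measurePreserving k).quasiMeasurePreserving
  set K := almostPeriodic (koopman h)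
  have hK : IsClosed (K : Set (Lp ℝ 2 ν)) := isClosed_almostPeriodic (koopman h)
  have : CompleteSpace K := hK.completeSpace_coe
  set v : Lp ℝ 2 ν := (hfu.memLp (ν := ν)).toLp with hv
  have hvf : v =ᵐ[ν] f := hfu.memLp.coeFn_toLp
  set p := K.starProjection v with hp
  have hpK : p ∈ K := K.starProjection_apply_mem v
  have horth : ∀ y ∈ K, ⟪v - p, y⟫_ℝ = 0 := K.starProjection_inner_eq_zero v
  have g0 : (fun t : ℝ => max 0 (min 1 t)) 0 = 0 := by simp
  set q := lipschitzWith_clamp.compLp g0 p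
  have hqK : q ∈ K := compLp_mem_almostPeriodic h _ g0 hpK
  have hvv : lipschitzWith_clamp.compLp g0 v = v := by
    refine Lp.ext ((lipschitzWith_clamp.coeFn_compLp g0 v).trans ?_)
    filter_upwards [hvf] with x hx
    rw [Function.comp_apply, hx, min_eq_right (hf' x).2, max_eq_right (hf' x).1]
  have hqp : q = p := by
    have h1 : ‖v - q‖ ≤ ‖v - p‖ := by
      have := lipschitzWith_clamp.norm_compLp_sub_le g0 v p
      rwa [hvv, NNReal.coe_one, one_mul] at this
    have h2 : ‖v - q‖ * ‖v - q‖ = ‖v - p‖ * ‖v - p‖ + ‖p - q‖ * ‖p - q‖ := by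
      rw [← norm_add_sq_eq_norm_sq_add_norm_sq_real (horth _ (K.sub_mem hpK hqK)),
        sub_add_sub_cancel]
    have h3 : ‖p - q‖ = 0 := by
      nlinarith [norm_nonneg (v - q), norm_nonneg (v - p), norm_nonneg (p - q)]
    exact (sub_eq_zero.1 (norm_eq_zero.1 h3)).symm
  set φ : X → ℝ := fun x => max 0 (min 1 (p x)) with hφ
  have hφm : Measurable φ :=
    measurable_const.max (measurable_const.min (Lp.stronglyMeasurable p).measurable)
  have hφ' : ∀ x, 0 ≤ φ x ∧ φ x ≤ 1 := fun x =>
    ⟨le_max_left _ _, max_le zero_le_one (min_le_left _ _)⟩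
  have hφu : UnitBounded φ := ⟨hφm, fun x => abs_le.2 ⟨by linarith [hφ' x], (hφ' x).2⟩⟩
  have hpφ : p =ᵐ[ν] φ := by
    have := lipschitzWith_clamp.coeFn_compLp g0 p
    change q =ᵐ[ν] φ at this
    rwa [hqp] at this
  refine ⟨φ, hφm, hφ', ?_, ?_, ?_⟩
  · have h1 := horth _ (one_mem_almostPeriodic h)
    rw [inner_eq_integral] at h1
    have h2 : ∫ x, f x - φ x ∂ν = 0 := by
      rw [← h1]
      refine integral_congr_ae ?_
      filter_upwards [Lp.coeFn_sub v p, hvf, hpφ,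
        (memLp_const (p := 2) (μ := ν) (1 : ℝ)).coeFn_toLp]
        with x e1 e2 e3 e4
      rw [e1, e4, Pi.sub_apply, e2, e3, mul_one]
    rw [integral_sub hfu.integrable hφu.integrable] at h2
    linarith
  · intro ε hε
    obtain ⟨t, ht, htf, htc⟩ := Metric.finite_approx_of_totallyBounded
      ((mem_almostPeriodic _).1 hpK) ε hε
    choose! ι hι using fun y (hy : y ∈ t) => ht hy
    refine ⟨htf.toFinset.image ι, fun n => ?_⟩
    have hn : koopman h n p ∈ ⋃ y ∈ t, Metric.ball y ε := htc ⟨n, rfl⟩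
    obtain ⟨y, hy, hny⟩ := Set.mem_iUnion₂.1 hn
    refine ⟨ι y, Finset.mem_image_of_mem ι (htf.mem_toFinset.2 hy), ?_⟩
    rw [← hι y hy] at hny
    set j := ι y
    refine le_of_sq_le_sq ?_ hε.le
    have hm : MemLp (fun x => φ (T n x) - φ (T j x)) 2 ν :=
      (hφu.comp (hT n)).memLp.sub (hφu.comp (hT j)).memLp
    refine (sq_integral_abs_le hm).trans ?_
    have h1 : ∫ x, (φ (T n x) - φ (T j x)) ^ 2 ∂ν = ‖koopman h n p - koopman h j p‖ ^ 2 := by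
      rw [norm_sq_eq_integral]
      refine integral_congr_ae ?_
      filter_upwards [Lp.coeFn_sub (koopman h n p) (koopman h j p), coeFn_koopman h n p,
        coeFn_koopman h j p, (hqmp n).ae_eq_comp hpφ, (hqmp j).ae_eq_comp hpφ]
        with x e1 e2 e3 e4 e5
      simp only [Function.comp_apply] at e2 e3 e4 e5
      rw [e1, Pi.sub_apply, e2, e3, e4, e5]
    rw [h1, ← dist_eq_norm]
    exact pow_le_pow_left₀ dist_nonneg (Metric.mem_ball.1 hny).le 2
  · refine (tendsto_correlations_of_orthogonal (koopman_zero h) (koopman_add h) horth).congr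
      fun N => ?_
    have h1 : ∀ k l : ℕ, ⟪koopman h k (v - p), koopman h l (v - p)⟫_ℝ =
        ∫ x, (f (T k x) - φ (T k x)) * (f (T l x) - φ (T l x)) ∂ν := by
      intro k l
      rw [inner_eq_integral]
      refine integral_congr_ae ?_
      have hw : (v - p : Lp ℝ 2 ν) =ᵐ[ν] fun x => f x - φ x := by
        filter_upwards [Lp.coeFn_sub v p, hvf, hpφ] with x e1 e2 e3
        rw [e1, Pi.sub_apply, e2, e3]
      filter_upwards [coeFn_koopman h k (v - p), coeFn_koopman h l (v - p),
        (hqmp k).ae_eq_comp hw, (hqmp l).ae_eq_comp hw] with x e1 e2 e3 e4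
      rw [e1, e2, e3, e4]
      rfl
    simp_rw [h1]
    rw [← Finset.mul_sum, mul_assoc]

theorem eventually_le_windowAverage_of_ergodic [IsProbabilityMeasure ν]
    (h : IsMeasurePreservingAction T ν) (he : Ergodic (T 1) ν) {f : X → ℝ} (hf : Measurable f)
    (hf' : ∀ x, 0 ≤ f x ∧ f x ≤ 1) {ε : ℝ} (hε : 0 < ε) :
    ∀ᶠ L : ℕ in atTop, ∀ᶠ L' : ℕ in atTop, ∀ a b : ℤ,
      (∫ x, f x ∂ν) ^ 4 - ε ≤ windowAverage L L' (correlation T ν f f f f) a b := by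
  obtain ⟨φ, hφ, hφ', hInt, hc, hmix⟩ := exists_compact_weaklyMixing_decomposition h hf hf'
  have hfu : UnitBounded f := ⟨hf, fun x => abs_le.2 ⟨by linarith [hf' x], (hf' x).2⟩⟩
  have hφu : UnitBounded φ := ⟨hφ, fun x => abs_le.2 ⟨by linarith [hφ' x], (hφ' x).2⟩⟩
  have hw : UnitBounded fun x => f x - φ x := ⟨hf.sub hφ, fun x =>
    abs_le.2 ⟨by linarith [hφ' x, hf' x], by linarith [hφ' x, hf' x]⟩⟩
  filter_upwards [hc.eventually_le_windowAverage h he hφu (half_pos hε),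
    hmix.smallOnAverage_sub h he hfu hφu hw (ε / 2) (half_pos hε)] with L h1 h2
  filter_upwards [h1, h2] with L' h1 h2 a b
  have h3 := windowAverage_add L L' (fun n m => correlation T ν f f f f n m -
    correlation T ν φ φ φ φ n m) (correlation T ν φ φ φ φ) a b
  simp only [sub_add_cancel] at h3
  have h4 := h1 a b
  rw [hInt] at h4
  change windowAverage L L' (correlation T ν f f f f) a b = _ at h3
  linarith [(abs_le.1 (h2 a b)).1]

end CompactPart

section ErgodicityCriterion

open scoped Topology

variable {X : Type*} [MeasurableSpace X] {T : ℤ → X → X} {ν : Measure X}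

theorem isMeasurePreservingAction_of_map_one (hm : ∀ n, Measurable (T n)) (h0 : T 0 = id)
    (hadd : ∀ m n, T (m + n) = T m ∘ T n) (h1 : ν.map (T 1) = ν) :
    IsMeasurePreservingAction T ν where
  measurePreserving n := by
    have h1' : MeasurePreserving (T 1) ν ν := ⟨hm 1, h1⟩
    have hneg : MeasurePreserving (T (-1)) ν ν := by
      refine ⟨hm _, ?_⟩
      conv_lhs => rw [← h1]
      rw [Measure.map_map (hm _) (hm _), ← hadd]
      norm_num [h0]
    induction n using Int.induction_on with
    | zero => rw [h0]; exact MeasurePreserving.id ν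
    | succ k ih => rw [hadd]; exact ih.comp h1'
    | pred k ih => rw [sub_eq_add_neg, hadd]; exact ih.comp hneg
  zero := h0
  add := hadd

theorem unitBounded_indicator {C : Set X} (hC : MeasurableSet C) :
    UnitBounded (C.indicator fun _ => (1 : ℝ)) :=
  ⟨measurable_const.indicator hC, fun x => by by_cases hx : x ∈ C <;> simp [hx]⟩

theorem integral_ergodicAverage [IsProbabilityMeasure ν] (h : IsMeasurePreservingAction T ν)
    {g : X → ℝ} (hg : UnitBounded g) {N : ℕ} (hN : 0 < N) :
    ∫ x, ergodicAverage T g N x ∂ν = ∫ x, g x ∂ν := by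
  have hT := fun k => (h.measurePreserving k).measurable
  unfold ergodicAverage
  rw [integral_const_mul, integral_finsetSum (Finset.range N) fun k _ =>
    (hg.comp (hT k)).integrable]
  simp_rw [h.integral_comp _ hg.measurable]
  rw [Finset.sum_const, Finset.card_range, nsmul_eq_mul]
  field_simp

theorem integral_sub_sq_ergodicAverage [IsProbabilityMeasure ν]
    (h : IsMeasurePreservingAction T ν) {g : X → ℝ} (hg : UnitBounded g) {N : ℕ} (hN : 0 < N) :
    ∫ x, (ergodicAverage T g N x - ∫ y, g y ∂ν) ^ 2 ∂ν =
      ∫ x, ergodicAverage T g N x ^ 2 ∂ν - (∫ y, g y ∂ν) ^ 2 := by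
  have hA := hg.ergodicAverage h N
  set c := ∫ y, g y ∂ν with hc
  have h1 : Integrable (fun x => ergodicAverage T g N x ^ 2) ν := hA.memLp.integrable_sq
  have h2 : Integrable (fun x => 2 * c * ergodicAverage T g N x) ν := hA.integrable.const_mul _
  calc ∫ x, (ergodicAverage T g N x - c) ^ 2 ∂ν
      = ∫ x, ((ergodicAverage T g N x ^ 2 - 2 * c * ergodicAverage T g N x) + c ^ 2) ∂ν := by
        congr 1 with x
        ring
    _ = ∫ x, ergodicAverage T g N x ^ 2 ∂ν - c ^ 2 := by
        have h3 : Integrable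
            (fun x => ergodicAverage T g N x ^ 2 - 2 * c * ergodicAverage T g N x) ν :=
            h1.sub h2
        rw [integral_add h3 (integrable_const _), integral_sub h1 h2, integral_const_mul,
          integral_ergodicAverage h hg hN]
        simp [← hc]
        ring

/-- A measure is ergodic as soon as, for a generating `π`-system of sets, the second moments of
the ergodic averages of the indicators converge to the square of the mean along a subsequence. -/
theorem ergodic_of_tendsto_integral_sq [IsProbabilityMeasure ν]
    (h : IsMeasurePreservingAction T ν) {𝒞 : Set (Set X)}
    (hgen : ‹MeasurableSpace X› = MeasurableSpace.generateFrom 𝒞) (hpi : IsPiSystem 𝒞)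
    (hconv : ∀ C ∈ 𝒞, ∃ ns : ℕ → ℕ, StrictMono ns ∧
      Tendsto (fun i => ∫ x, ergodicAverage T (C.indicator fun _ => (1 : ℝ)) (ns i) x ^ 2 ∂ν)
        atTop (𝓝 (ν.real C ^ 2))) :
    Ergodic (T 1) ν := by
  have hT := fun k => (h.measurePreserving k).measurable
  have hmeas : ∀ C ∈ 𝒞, MeasurableSet C := fun C hC => by
    rw [hgen]; exact MeasurableSpace.measurableSet_generateFrom hC
  refine ⟨h.measurePreserving 1, ⟨fun B hB hinv => ?_⟩⟩
  have hinvk : ∀ k : ℕ, T k ⁻¹' B = B := fun k => by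
    induction k with
    | zero => simp [h.zero]
    | succ k ih => rw [Nat.cast_succ, h.add, Set.preimage_comp, ih, hinv]
  have hmul : ∀ C ∈ 𝒞, ν.real (B ∩ C) = ν.real B * ν.real C := by
    intro C hC
    have hCm := hmeas C hC
    have hf := unitBounded_indicator hCm
    have hb := unitBounded_indicator hB
    set f : X → ℝ := C.indicator fun _ => (1 : ℝ) with hfdef
    set b : X → ℝ := B.indicator fun _ => (1 : ℝ) with hbdef
    have hfi : ∫ x, f x ∂ν = ν.real C := by
      rw [hfdef, integral_indicator hCm]; simp
    have hbi : ∫ x, b x ∂ν = ν.real B := by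
      rw [hbdef, integral_indicator hB]; simp
    have hbf : ∫ x, b x * f x ∂ν = ν.real (B ∩ C) := by
      have : (fun x => b x * f x) = (B ∩ C).indicator fun _ => (1 : ℝ) := by
        ext x
        by_cases h1 : x ∈ B <;> by_cases h2 : x ∈ C <;> simp [hbdef, hfdef, h1, h2]
      rw [this, integral_indicator (hB.inter hCm)]
      simp
    have hbT : ∀ (k : ℕ) (x : X), b (T k x) = b x := fun k x => by
      have : T k x ∈ B ↔ x ∈ B := by rw [← Set.mem_preimage, hinvk k]
      by_cases hx : x ∈ B <;> simp [hbdef, hx, this]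
    have hcorr : ∀ N : ℕ, 0 < N →
        ∫ x, b x * ergodicAverage T f N x ∂ν = ν.real (B ∩ C) := by
      intro N hN
      rw [← hbf, ← integral_ergodicAverage h (hb.mul hf) hN]
      congr 1 with x
      simp only [_root_.ergodicAverage, hbT]
      rw [← Finset.mul_sum]
      ring
    have hle : ∀ N : ℕ, 0 < N → (ν.real (B ∩ C) - ν.real B * ν.real C) ^ 2 ≤
        ∫ x, ergodicAverage T f N x ^ 2 ∂ν - ν.real C ^ 2 := by
      intro N hN
      have hA := hf.ergodicAverage h N
      rw [← hfi, ← integral_sub_sq_ergodicAverage h hf hN]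
      refine le_trans (le_of_eq ?_)
        (hb.sq_integral_mul_le (F := fun x => ergodicAverage T f N x - ∫ y, f y ∂ν)
          (hA.memLp.sub (memLp_const _)))
      congr 1
      simp_rw [mul_sub]
      rw [integral_sub (hb.mul hA).integrable (hb.integrable.mul_const _), hcorr N hN,
        integral_mul_const, hbi]
    obtain ⟨ns, hns, hlim⟩ := hconv C hC
    have h0 : (ν.real (B ∩ C) - ν.real B * ν.real C) ^ 2 ≤ 0 := by
      have hlim' := hlim.sub_const (ν.real C ^ 2)
      rw [sub_self] at hlim'
      refine ge_of_tendsto hlim' ?_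
      filter_upwards [eventually_gt_atTop 0] with i hi
      exact hle _ (hi.trans_le hns.le_apply)
    nlinarith [sq_nonneg (ν.real (B ∩ C) - ν.real B * ν.real C)]
  have hext : ν.restrict B = ν B • ν := by
    have : IsFiniteMeasure (ν B • ν) := Measure.smul_finite _ (measure_ne_top _ _)
    refine ext_of_generate_finite 𝒞 hgen hpi (fun C hC => ?_) (by simp)
    rw [Measure.restrict_apply (hmeas C hC), Measure.smul_apply, smul_eq_mul, Set.inter_comm]
    rw [← ENNReal.toReal_eq_toReal_iff' (measure_ne_top _ _)
      (ENNReal.mul_ne_top (measure_ne_top _ _) (measure_ne_top _ _)), ENNReal.toReal_mul]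
    exact hmul C hC
  have hBB : ν B = ν B * ν B := by
    have := congrArg (fun m => m B) hext
    simpa [Measure.restrict_apply hB] using this
  rw [eventuallyConst_set']
  rcases eq_or_ne (ν B) 0 with h0 | h0
  · exact Or.inl (ae_eq_empty.2 h0)
  · right
    rw [ae_eq_univ, prob_compl_eq_zero_iff hB]
    exact ((ENNReal.mul_eq_left h0 (measure_ne_top _ _)).1 hBB.symm)

end ErgodicityCriterion

section ErgodicDecomposition

open ProbabilityTheory
open scoped Topology

variable {X : Type*} [MeasurableSpace X] {T : ℤ → X → X} {μ : Measure X}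

/-- The σ-algebra of the measurable sets that are invariant under `S` up to a null set. -/
@[reducible]
def aeInvariants (S : X → X) (μ : Measure X) : MeasurableSpace X where
  MeasurableSet' B := MeasurableSet B ∧ S ⁻¹' B =ᵐ[μ] B
  measurableSet_empty := ⟨MeasurableSet.empty, by simp⟩
  measurableSet_compl B hB := ⟨hB.1.compl, hB.2.compl⟩
  measurableSet_iUnion B hB := ⟨MeasurableSet.iUnion fun i => (hB i).1, by
    rw [Set.preimage_iUnion]
    exact Filter.EventuallyEq.countable_iUnion fun i => (hB i).2⟩

theorem aeInvariants_le (S : X → X) (μ : Measure X) : aeInvariants S μ ≤ ‹MeasurableSpace X› :=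
  fun _ hB => hB.1

theorem measurable_aeInvariants {S : X → X} {z : X → ℝ} (hz : Measurable z)
    (hinv : z ∘ S =ᵐ[μ] z) : Measurable[aeInvariants S μ] z := by
  intro s hs
  refine ⟨hz hs, ?_⟩
  filter_upwards [hinv] with x hx
  exact propext (by
    change z (S x) ∈ s ↔ z x ∈ s
    rw [← hx]
    rfl)

theorem condExp_preimage_aeInvariants [IsProbabilityMeasure μ] {S : X → X}
    (hS : MeasurePreserving S μ μ) {C : Set X} (hC : MeasurableSet C) :
    μ⟦S ⁻¹' C | aeInvariants S μ⟧ =ᵐ[μ] μ⟦C | aeInvariants S μ⟧ := by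
  have hle := aeInvariants_le S μ
  have hSC : MeasurableSet (S ⁻¹' C) := hS.measurable hC
  refine ae_eq_condExp_of_forall_setIntegral_eq hle ((integrable_const 1).indicator hC)
    (fun s _ _ => integrable_condExp.integrableOn) (fun s hs _ => ?_)
    stronglyMeasurable_condExp.aestronglyMeasurable
  rw [setIntegral_condExp hle ((integrable_const 1).indicator hSC) hs,
    setIntegral_indicator hSC, setIntegral_indicator hC]
  simp only [integral_const, smul_eq_mul, mul_one, measureReal_restrict_apply_univ]
  rw [← measureReal_congr (hs.2.inter (ae_eq_refl (S ⁻¹' C))), ← Set.preimage_inter]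
  exact hS.measureReal_preimage (hs.1.inter hC).nullMeasurableSet

variable [StandardBorelSpace X]

theorem ae_map_condExpKernel_eq [IsProbabilityMeasure μ] {S : X → X}
    (hS : MeasurePreserving S μ μ) {𝒞 : Set (Set X)} (hcount : 𝒞.Countable)
    (hgen : ‹MeasurableSpace X› = MeasurableSpace.generateFrom 𝒞) (hpi : IsPiSystem 𝒞) :
    ∀ᵐ x ∂μ, (condExpKernel μ (aeInvariants S μ) x).map S =
      condExpKernel μ (aeInvariants S μ) x := by
  have hmeas : ∀ C ∈ 𝒞, MeasurableSet C := fun C hC => by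
    rw [hgen]; exact MeasurableSpace.measurableSet_generateFrom hC
  have hle := aeInvariants_le S μ
  have key : ∀ᵐ x ∂μ, ∀ C ∈ 𝒞, (condExpKernel μ (aeInvariants S μ) x).real (S ⁻¹' C) =
      (condExpKernel μ (aeInvariants S μ) x).real C := by
    rw [ae_ball_iff hcount]
    intro C hC
    exact (condExpKernel_ae_eq_condExp hle (hS.measurable (hmeas C hC))).trans
      ((condExp_preimage_aeInvariants hS (hmeas C hC)).trans
        (condExpKernel_ae_eq_condExp hle (hmeas C hC)).symm)
  filter_upwards [key] with x hx
  have : IsProbabilityMeasure ((condExpKernel μ (aeInvariants S μ) x).map S) :=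
    Measure.isProbabilityMeasure_map hS.measurable.aemeasurable
  refine ext_of_generate_finite 𝒞 hgen hpi (fun C hC => ?_) (by simp)
  rw [Measure.map_apply hS.measurable (hmeas C hC),
    ← ENNReal.toReal_eq_toReal_iff' (measure_ne_top _ _) (measure_ne_top _ _)]
  exact hx C hC

theorem integral_integral_condExpKernel [IsProbabilityMeasure μ] (S : X → X) {f : X → ℝ}
    (hf : Integrable f μ) :
    ∫ x, ∫ y, f y ∂(condExpKernel μ (aeInvariants S μ) x) ∂μ = ∫ x, f x ∂μ := by
  rw [← integral_condExp (aeInvariants_le S μ) (f := f)]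
  exact integral_congr_ae (condExp_ae_eq_integral_condExpKernel (aeInvariants_le S μ) hf).symm

theorem exists_seq_tendsto_integral_sq_condExpKernel [IsProbabilityMeasure μ]
    (h : IsMeasurePreservingAction T μ)
    (hinv : ∀ᵐ x ∂μ, IsMeasurePreservingAction T (condExpKernel μ (aeInvariants (T 1) μ) x))
    {C : Set X} (hC : MeasurableSet C) :
    ∃ ns : ℕ → ℕ, StrictMono ns ∧ ∀ᵐ x ∂μ, Tendsto
      (fun i => ∫ y, ergodicAverage T (C.indicator fun _ => (1 : ℝ)) (ns i) y ^ 2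
        ∂(condExpKernel μ (aeInvariants (T 1) μ) x)) atTop
        (𝓝 ((condExpKernel μ (aeInvariants (T 1) μ) x).real C ^ 2)) := by
  have hle := aeInvariants_le (T 1) μ
  set κ := condExpKernel μ (aeInvariants (T 1) μ) with hκ
  have hf := unitBounded_indicator hC
  set f : X → ℝ := C.indicator fun _ => (1 : ℝ) with hfdef
  obtain ⟨z, hz, hz', -, hlim⟩ := exists_tendsto_ergodicAverage h hf
  have hzm : Measurable z := (Lp.stronglyMeasurable z).measurable
  have hz2 : MemLp z 2 μ := Lp.memLp z
  have hzκ : ∀ᵐ x ∂μ, (κ x).real C = z x := by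
    have h1 : z =ᵐ[μ] μ[f | aeInvariants (T 1) μ] := by
      refine ae_eq_condExp_of_forall_setIntegral_eq hle hf.integrable
        (fun s _ _ => (hz2.integrable one_le_two).integrableOn) (fun s hs _ => ?_)
        (measurable_aeInvariants hzm hz).stronglyMeasurable.aestronglyMeasurable
      have hb := (unitBounded_indicator hs.1).memLp (ν := μ)
      have hb' := hb.coeFn_toLp
      have h2 := hz' (hb.toLp _) (by
        refine ((h.measurePreserving 1).quasiMeasurePreserving.ae_eq_comp hb').trans
          (EventuallyEq.trans ?_ hb'.symm)
        filter_upwards [hs.2] with x hx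
        have hx' : T 1 x ∈ s ↔ x ∈ s := iff_of_eq hx
        by_cases hxs : x ∈ s <;> simp [hx', hxs])
      have h3 : ∀ w : X → ℝ, ∫ x, w x * hb.toLp _ x ∂μ = ∫ x in s, w x ∂μ := fun w => by
        rw [← integral_indicator hs.1]
        refine integral_congr_ae ?_
        filter_upwards [hb'] with x hx
        rw [hx]
        by_cases hxs : x ∈ s <;> simp [hxs]
      rw [← h3, ← h3, h2]
    filter_upwards [h1, condExpKernel_ae_eq_condExp hle hC] with x h1 h2
    rw [h1, h2]
  have hA := fun N => hf.ergodicAverage h N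
  have hsq : ∀ N, Integrable (fun x => ergodicAverage T f N x ^ 2) μ := fun N =>
    (hA N).memLp.integrable_sq
  set V : ℕ → X → ℝ := fun N x => ∫ y, ergodicAverage T f N y ^ 2 ∂(κ x) - z x ^ 2 with hV
  have hVint : ∀ N, Integrable (V N) μ := fun N =>
    (hsq N).integral_condExpKernel.sub hz2.integrable_sq
  have hVnonneg : ∀ N, 0 < N → 0 ≤ᵐ[μ] V N := by
    intro N hN
    filter_upwards [hinv, hzκ] with x hx hzx
    have h1 := integral_sub_sq_ergodicAverage hx hf hN
    have h2 : ∫ y, f y ∂(κ x) = z x := by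
      rw [← hzx, hfdef, integral_indicator hC]; simp
    rw [h2] at h1
    simp only [hV, Pi.zero_apply]
    rw [← h1]
    exact integral_nonneg fun y => sq_nonneg _
  have hVlim : Tendsto (fun N => ∫ x, V N x ∂μ) atTop (𝓝 0) := by
    have := hlim.sub_const (∫ x, z x ^ 2 ∂μ)
    rw [sub_self] at this
    refine this.congr fun N => ?_
    simp only [hV]
    rw [integral_sub (hsq N).integral_condExpKernel hz2.integrable_sq,
      integral_integral_condExpKernel _ (hsq N)]
  have hV1 : Tendsto (fun N => eLpNorm (V N - 0) 1 μ) atTop (𝓝 0) := by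
    have := ENNReal.tendsto_ofReal hVlim
    rw [ENNReal.ofReal_zero] at this
    refine this.congr' ?_
    filter_upwards [eventually_gt_atTop 0] with N hN
    rw [sub_zero, eLpNorm_one_eq_lintegral_enorm,
      ← ofReal_integral_norm_eq_lintegral_enorm (hVint N)]
    congr 1
    refine integral_congr_ae ?_
    filter_upwards [hVnonneg N hN] with x hx
    exact (Real.norm_of_nonneg hx).symm
  obtain ⟨ns, hns, hae⟩ := (tendstoInMeasure_of_tendsto_eLpNorm one_ne_zero
    (fun N => (hVint N).aestronglyMeasurable) aestronglyMeasurable_zero hV1).exists_seq_tendsto_ae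
  refine ⟨ns, hns, ?_⟩
  filter_upwards [hae, hzκ] with x hx hzx
  have := hx.add_const (z x ^ 2)
  simpa [hV, hzx] using this

/-- The ergodic decomposition of a measure-preserving action. -/
theorem exists_ergodic_decomposition [IsProbabilityMeasure μ]
    (h : IsMeasurePreservingAction T μ) :
    ∃ κ : X → Measure X, (∀ x, IsProbabilityMeasure (κ x)) ∧
      (∀ f : X → ℝ, UnitBounded f → Measurable (fun x => ∫ y, f y ∂(κ x)) ∧
        ∫ x, ∫ y, f y ∂(κ x) ∂μ = ∫ x, f x ∂μ) ∧
      ∀ᵐ x ∂μ, IsMeasurePreservingAction T (κ x) ∧ Ergodic (T 1) (κ x) := by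
  have hle := aeInvariants_le (T 1) μ
  set 𝒞 : Set (Set X) := generateSetAlgebra (MeasurableSpace.countableGeneratingSet X) with h𝒞
  have hcount : 𝒞.Countable :=
    countable_generateSetAlgebra MeasurableSpace.countable_countableGeneratingSet
  have hgen : ‹MeasurableSpace X› = MeasurableSpace.generateFrom 𝒞 := by
    rw [generateFrom_generateSetAlgebra_eq, MeasurableSpace.generateFrom_countableGeneratingSet]
  have hpi : IsPiSystem 𝒞 := fun s hs t ht _ => isSetAlgebra_generateSetAlgebra.inter_mem hs ht
  have hmeas : ∀ C ∈ 𝒞, MeasurableSet C := fun C hC => by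
    rw [hgen]; exact MeasurableSpace.measurableSet_generateFrom hC
  refine ⟨condExpKernel μ (aeInvariants (T 1) μ), fun x => inferInstance, fun f hf => ⟨?_, ?_⟩, ?_⟩
  · exact (hf.measurable.stronglyMeasurable.integral_condExpKernel.mono hle).measurable
  · exact integral_integral_condExpKernel _ hf.integrable
  · have hinv : ∀ᵐ x ∂μ,
        IsMeasurePreservingAction T (condExpKernel μ (aeInvariants (T 1) μ) x) := by
      filter_upwards [ae_map_condExpKernel_eq (h.measurePreserving 1) hcount hgen hpi] with x hx
      exact isMeasurePreservingAction_of_map_one (fun n => (h.measurePreserving n).measurable)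
        h.zero h.add hx
    choose! ns hns hlim using fun C hC =>
      exists_seq_tendsto_integral_sq_condExpKernel h hinv (hmeas C hC)
    filter_upwards [hinv, (ae_ball_iff hcount).2 hlim] with x hx hx'
    exact ⟨hx, ergodic_of_tendsto_integral_sq hx hgen hpi fun C hC => ⟨ns C, hns C hC, hx' C hC⟩⟩

end ErgodicDecomposition

section LargeIntersections

open scoped Topology

variable {X : Type*} [MeasurableSpace X] {T : ℤ → X → X} {μ : Measure X}

theorem average_le_of_nonneg {F : ℕ → ℝ} {N : ℕ} {c : ℝ} (hc : 0 ≤ c) (hF : ∀ k < N, F k ≤ c) :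
    (N : ℝ)⁻¹ * ∑ k ∈ Finset.range N, F k ≤ c := by
  rcases N.eq_zero_or_pos with rfl | hN
  · simpa using hc
  · rw [inv_mul_le_iff₀ (by positivity)]
    refine (Finset.sum_le_card_nsmul _ _ c fun k hk => hF k (Finset.mem_range.1 hk)).trans ?_
    simp

theorem exists_lt_of_lt_windowAverage {L L' : ℕ} {F : ℤ → ℤ → ℝ} {a b : ℤ} {c : ℝ} (hc : 0 ≤ c)
    (h : c < windowAverage L L' F a b) : ∃ k < L', ∃ l < L, c < F (a + k) (b + l) := by
  by_contra! hcon
  refine h.not_ge (average_le_of_nonneg hc fun k hk => ?_)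
  exact average_le_of_nonneg hc fun l hl => hcon k hk l hl

theorem pow_four_integral_le [IsProbabilityMeasure μ] {g : X → ℝ} (hg : UnitBounded g) :
    (∫ x, g x ∂μ) ^ 4 ≤ ∫ x, g x ^ 4 ∂μ := by
  have h1 : UnitBounded fun _ : X => (1 : ℝ) := ⟨measurable_const, by simp⟩
  have h2 : UnitBounded fun x => g x ^ 2 := by simpa [pow_two] using hg.mul hg
  calc (∫ x, g x ∂μ) ^ 4 = ((∫ x, g x ∂μ) ^ 2) ^ 2 := by ring
    _ ≤ (∫ x, g x ^ 2 ∂μ) ^ 2 := by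
        gcongr
        simpa using h1.sq_integral_mul_le (ν := μ) hg.memLp
    _ ≤ ∫ x, (g x ^ 2) ^ 2 ∂μ := by
        simpa using h1.sq_integral_mul_le (ν := μ) h2.memLp
    _ = ∫ x, g x ^ 4 ∂μ := by
        congr 1 with x
        ring

theorem unitBounded_correlation {f : X → ℝ} (hf : UnitBounded f) (hT : ∀ n, Measurable (T n))
    (n m : ℤ) : UnitBounded fun x => f x * f (T n x) * (f (T m x) * f (T (n + m) x)) :=
  (hf.mul (hf.comp (hT n))).mul ((hf.comp (hT m)).mul (hf.comp (hT (n + m))))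

theorem exists_lt_windowAverage [StandardBorelSpace X] [IsProbabilityMeasure μ]
    (h : IsMeasurePreservingAction T μ) {f : X → ℝ} (hf : Measurable f)
    (hf' : ∀ x, 0 ≤ f x ∧ f x ≤ 1) {c : ℝ} (hc : 0 ≤ c) (hcf : c < (∫ x, f x ∂μ) ^ 4) :
    ∃ L L' : ℕ, ∀ a b : ℤ, c < windowAverage L L' (correlation T μ f f f f) a b := by
  have hfu : UnitBounded f := ⟨hf, fun x => abs_le.2 ⟨by linarith [hf' x], (hf' x).2⟩⟩
  have hT := fun n => (h.measurePreserving n).measurable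
  obtain ⟨κ, hκ, hκ', hκe⟩ := exists_ergodic_decomposition h
  have hu := unitBounded_correlation hfu hT
  set ε := ((∫ x, f x ∂μ) ^ 4 - c) / 2 with hε
  have hε0 : 0 < ε := by rw [hε]; linarith
  set W : ℕ → ℕ → ℤ → ℤ → X → ℝ := fun L L' a b x =>
    windowAverage L L' (correlation T (κ x) f f f f) a b with hW
  have hcm : ∀ n m, Measurable fun x => correlation T (κ x) f f f f n m := fun n m =>
    (hκ' _ (hu n m)).1
  have hcb : ∀ n m, UnitBounded fun x => correlation T (κ x) f f f f n m := fun n m =>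
    ⟨hcm n m, fun x => (hu n m).abs_integral_le⟩
  have hWu : ∀ L L' a b, UnitBounded (W L L' a b) := fun L L' a b =>
    UnitBounded.average (fun k => UnitBounded.average (fun l => hcb _ _) L) L'
  have hW0 : ∀ L L' a b x, 0 ≤ W L L' a b x := fun L L' a b x => by
    simp only [hW, windowAverage]
    refine mul_nonneg (by positivity) (Finset.sum_nonneg fun k _ =>
      mul_nonneg (by positivity) (Finset.sum_nonneg fun l _ => integral_nonneg fun y => ?_))
    exact mul_nonneg (mul_nonneg (hf' _).1 (hf' _).1) (mul_nonneg (hf' _).1 (hf' _).1)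
  have hWint : ∀ L L' a b, ∫ x, W L L' a b x ∂μ =
      windowAverage L L' (correlation T μ f f f f) a b := fun L L' a b => by
    simp only [hW, windowAverage]
    rw [integral_const_mul, integral_finsetSum (Finset.range L') fun k _ =>
      (UnitBounded.average (fun l => hcb (a + k) (b + l)) L).integrable]
    congr 1
    refine Finset.sum_congr rfl fun k _ => ?_
    rw [integral_const_mul, integral_finsetSum (Finset.range L) fun l _ =>
      (hcb (a + k) (b + l)).integrable]
    congr 1
    exact Finset.sum_congr rfl fun l _ => (hκ' _ (hu _ _)).2
  set m : X → ℝ := fun x => ∫ y, f y ∂(κ x) with hm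
  have hmu : UnitBounded m := ⟨(hκ' f hfu).1, fun x => hfu.abs_integral_le⟩
  set G : ℕ → ℕ → X → ENNReal := fun L L' x =>
    ⨅ p : ℤ × ℤ, ENNReal.ofReal (W L L' p.1 p.2 x + ε) with hG
  have hGm : ∀ L L', Measurable (G L L') := fun L L' =>
    Measurable.iInf fun p => ((hWu L L' p.1 p.2).measurable.add_const ε).ennreal_ofReal
  have hlow : ∀ᵐ x ∂μ, ENNReal.ofReal (m x ^ 4) ≤
      liminf (fun L => liminf (fun L' => G L L' x) atTop) atTop := by
    filter_upwards [hκe] with x hx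
    refine le_liminf_of_le (by isBoundedDefault) ?_
    filter_upwards [eventually_le_windowAverage_of_ergodic hx.1 hx.2 hf hf' hε0] with L hL
    refine le_liminf_of_le (by isBoundedDefault) ?_
    filter_upwards [hL] with L' hL'
    exact le_iInf fun p => ENNReal.ofReal_le_ofReal (by linarith [hL' p.1 p.2])
  have hmain : ENNReal.ofReal (c + ε) <
      liminf (fun L => liminf (fun L' => ∫⁻ x, G L L' x ∂μ) atTop) atTop := by
    calc ENNReal.ofReal (c + ε) < ENNReal.ofReal (∫ x, m x ^ 4 ∂μ) := by
          refine (ENNReal.ofReal_lt_ofReal_iff_of_nonneg (by positivity)).2 ?_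
          refine lt_of_lt_of_le ?_ (pow_four_integral_le hmu)
          rw [hm, (hκ' f hfu).2]
          linarith
      _ = ∫⁻ x, ENNReal.ofReal (m x ^ 4) ∂μ := by
          refine ofReal_integral_eq_lintegral_ofReal ?_
            (Eventually.of_forall fun x => by positivity)
          have : UnitBounded fun x => m x * m x * (m x * m x) := (hmu.mul hmu).mul (hmu.mul hmu)
          refine this.integrable.congr (Eventually.of_forall fun x => ?_)
          ring
      _ ≤ ∫⁻ x, liminf (fun L => liminf (fun L' => G L L' x) atTop) atTop ∂μ :=
          lintegral_mono_ae hlow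
      _ ≤ liminf (fun L => ∫⁻ x, liminf (fun L' => G L L' x) atTop ∂μ) atTop :=
          lintegral_liminf_le fun L => Measurable.liminf fun L' => hGm L L'
      _ ≤ liminf (fun L => liminf (fun L' => ∫⁻ x, G L L' x ∂μ) atTop) atTop :=
          liminf_le_liminf (Eventually.of_forall fun L => lintegral_liminf_le fun L' => hGm L L')
  obtain ⟨L, hL⟩ := (eventually_lt_of_lt_liminf hmain).exists
  obtain ⟨L', hL'⟩ := (eventually_lt_of_lt_liminf hL).exists
  refine ⟨L, L', fun a b => ?_⟩
  have h1 : ENNReal.ofReal (c + ε) < ENNReal.ofReal (∫ x, W L L' a b x + ε ∂μ) := by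
    have hInt : Integrable (fun x => W L L' a b x + ε) μ :=
      (hWu L L' a b).integrable.add (integrable_const ε)
    rw [ofReal_integral_eq_lintegral_ofReal hInt
      (Eventually.of_forall fun x => add_nonneg (hW0 L L' a b x) hε0.le)]
    exact hL'.trans_le (lintegral_mono fun x => iInf_le _ (a, b))
  have h2 := (ENNReal.ofReal_lt_ofReal_iff_of_nonneg (by positivity)).1 h1
  rw [integral_add (hWu L L' a b).integrable (integrable_const ε), hWint] at h2
  simpa using h2

theorem integral_indicator_correlation (hadd : ∀ m n, T (m + n) = T m ∘ T n)
    (hT : ∀ n, Measurable (T n)) {A : Set X} (hA : MeasurableSet A) (n m : ℤ) :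
    correlation T μ (A.indicator fun _ => 1) (A.indicator fun _ => 1) (A.indicator fun _ => 1)
      (A.indicator fun _ => 1) n m = μ.real ((A ∩ T n ⁻¹' A) ∩ T m ⁻¹' (A ∩ T n ⁻¹' A)) := by
  have hB : MeasurableSet (A ∩ T n ⁻¹' A) := hA.inter (hT n hA)
  rw [← integral_indicator_one (hB.inter (hT m hB))]
  unfold correlation
  congr 1 with x
  have hnm : T (n + m) x = T n (T m x) := by rw [hadd]; rfl
  rw [hnm]
  by_cases h1 : x ∈ A <;> by_cases h2 : T n x ∈ A <;> by_cases h3 : T m x ∈ A <;>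
    by_cases h4 : T n (T m x) ∈ A <;> simp [h1, h2, h3, h4]

theorem exists_window_forall_lt_measureReal [IsProbabilityMeasure μ]
    (h : IsMeasurePreservingAction T μ) {A : Set X} (hA : MeasurableSet A) {c : ℝ} (hc : 0 ≤ c)
    (hcA : c < μ.real A ^ 4) :
    ∃ L L' : ℕ, ∀ a b : ℤ, ∃ k < L', ∃ l < L,
      c < μ.real ((A ∩ T (a + k) ⁻¹' A) ∩ T (b + l) ⁻¹' (A ∩ T (a + k) ⁻¹' A)) := by
  classical
  have hT := fun n => (h.measurePreserving n).measurable
  set π : X → ℤ → Bool := fun x k => decide (T k x ∈ A) with hπ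
  have hπm : Measurable π := measurable_pi_lambda _ fun k =>
    measurable_to_bool (by
      have : (fun x => decide (T k x ∈ A)) ⁻¹' {true} = T k ⁻¹' A := by ext x; simp
      simpa only [hπ, this] using hT k hA)
  set S : ℤ → (ℤ → Bool) → ℤ → Bool := fun n y k => y (k + n) with hS
  have hSm : ∀ n, Measurable (S n) := fun n =>
    measurable_pi_lambda _ fun k => measurable_pi_apply (k + n)
  have hcomm : ∀ n x, π (T n x) = S n (π x) := fun n x => by
    ext k
    simp only [hπ, hS, h.apply_add]
  have hν : IsProbabilityMeasure (μ.map π) := Measure.isProbabilityMeasure_map hπm.aemeasurable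
  have hact : IsMeasurePreservingAction S (μ.map π) := by
    refine isMeasurePreservingAction_of_map_one hSm ?_ ?_ ?_
    · ext y k
      simp [hS]
    · intro p q
      ext y k
      simp [hS, add_assoc]
    · rw [Measure.map_map (hSm 1) hπm]
      have : S 1 ∘ π = π ∘ T 1 := funext fun x => (hcomm 1 x).symm
      rw [this, ← Measure.map_map hπm (hT 1), (h.measurePreserving 1).map_eq]
  set A' : Set (ℤ → Bool) := (fun y => y 0) ⁻¹' {true} with hA'
  have hA'm : MeasurableSet A' := measurable_pi_apply 0 (measurableSet_singleton true)
  have hmem : ∀ x, π x ∈ A' ↔ x ∈ A := fun x => by simp [hπ, hA', h.zero]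
  set f : (ℤ → Bool) → ℝ := A'.indicator fun _ => 1 with hf
  have hfπ : ∀ x, f (π x) = A.indicator (fun _ => (1 : ℝ)) x := fun x => by
    by_cases hx : x ∈ A <;> simp [hf, hmem, hx]
  have hfm : Measurable f := measurable_const.indicator hA'm
  have hf01 : ∀ y, 0 ≤ f y ∧ f y ≤ 1 := fun y => by
    by_cases hy : y ∈ A' <;> simp [hf, hy]
  have hfint : ∫ y, f y ∂(μ.map π) = μ.real A := by
    rw [integral_map hπm.aemeasurable hfm.aestronglyMeasurable]
    simp_rw [hfπ]
    exact integral_indicator_one hA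
  have hcorr : ∀ n m, correlation S (μ.map π) f f f f n m =
      μ.real ((A ∩ T n ⁻¹' A) ∩ T m ⁻¹' (A ∩ T n ⁻¹' A)) := fun n m => by
    rw [← integral_indicator_correlation h.add hT hA n m]
    have hfu : UnitBounded f := ⟨hfm, fun y => abs_le.2 ⟨by linarith [hf01 y], (hf01 y).2⟩⟩
    unfold correlation
    rw [integral_map hπm.aemeasurable
      (unitBounded_correlation hfu hSm n m).measurable.aestronglyMeasurable]
    simp_rw [← hcomm, hfπ]
  obtain ⟨L, L', hLL⟩ := exists_lt_windowAverage hact hfm hf01 hc (by rwa [hfint])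
  refine ⟨L, L', fun a b => ?_⟩
  obtain ⟨k, hk, l, hl, hkl⟩ := exists_lt_of_lt_windowAverage hc (hLL a b)
  exact ⟨k, hk, l, hl, by rwa [hcorr] at hkl⟩

end LargeIntersections

/-- For an invertible measure-preserving transformation (modeled as a
measure-preserving `ℤ`-action, so that `TⁿA = (T⁻ⁿ)⁻¹A`) of a probability space, any
`0 < λ < 1` and any `A` of positive measure, the set
`{(n,m) : μ((A ∩ TⁿA) ∩ Tᵐ(A ∩ TⁿA)) > λ μ(A)⁴}` is syndetic in `ℤ²`. -/
theorem syndetic_large_intersections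
    {X : Type*} [MeasurableSpace X] (μ : Measure X) [IsProbabilityMeasure μ]
    (T : ℤ → X → X)
    (hT : ∀ n : ℤ, MeasurePreserving (T n) μ μ)
    (hT0 : T 0 = id)
    (hTadd : ∀ n m : ℤ, T (n + m) = T n ∘ T m)
    (lam : ℝ) (hlam0 : 0 < lam) (hlam1 : lam < 1)
    (A : Set X) (hA : MeasurableSet A) (hApos : 0 < μ A) :
    SyndeticZ2 {p : ℤ × ℤ |
      lam * (μ A).toReal ^ 4 <
        (μ ((A ∩ T (-p.1) ⁻¹' A) ∩ T (-p.2) ⁻¹' (A ∩ T (-p.1) ⁻¹' A))).toReal} := by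
  have hpos : 0 < (μ A).toReal := ENNReal.toReal_pos hApos.ne' (measure_ne_top _ _)
  obtain ⟨L, L', hLL⟩ := exists_window_forall_lt_measureReal (μ := μ) ⟨hT, hT0, hTadd⟩ hA
    (c := lam * (μ A).toReal ^ 4) (by positivity)
    (mul_lt_of_lt_one_left (by simpa [measureReal_def] using pow_pos hpos 4) hlam1)
  refine ⟨L + L' + 1, by positivity, fun a b => ?_⟩
  obtain ⟨k, hk, l, hl, hkl⟩ := hLL (1 - a - L') (1 - b - L)
  refine ⟨-(1 - a - L' + k), -(1 - b - L + l), by omega, by omega, by omega, by omega, ?_⟩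
  simp only [Set.mem_ofPred_eq, neg_neg]
  exact hkl
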